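/- Let A = [[m,0,0],[0,a,b],[0,c,d]] with m > 1 an integer, ad − bc = 1, eigenvalue λ > 1 of the 2×2 block, and λ^{1/2} < m ≤ λ. Then dim_H R_τ = min{ (2log m+log λ)/(τ+log m), 3log λ/(τ+log λ), (log λ+log m)/τ, (τ+log λ)/τ }. -/

import Mathlib

open Filter MeasureTheory

noncomputable def intVec3 (z : Fin 3 → ℤ) : EuclideanSpace ℝ (Fin 3) :=
  (WithLp.equiv 2 (Fin 3 → ℝ)).symm fun i => (z i : ℝ)

/-- The lift to `ℝ³` of the recurrence set
`R_τ = {x ∈ 𝕋³ : Tⁿx ∈ B(x, e^{-nτ}) for infinitely many n}`, `T x = A x (mod 1)`. -/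
noncomputable def recSet3 (A : Matrix (Fin 3) (Fin 3) ℤ) (τ : ℝ) :
    Set (EuclideanSpace ℝ (Fin 3)) :=
  {x | ∃ᶠ n : ℕ in atTop, ∃ z : Fin 3 → ℤ,
    ‖Matrix.toEuclideanLin ((A ^ n).map (Int.cast : ℤ → ℝ)) x - x - intVec3 z‖
      < Real.exp (-(n : ℝ) * τ)}

open Metric Topology

/-- The radii used to discretise mass distribution estimates. -/
noncomputable def dyadicRadius (j : ℕ) : ℝ := (1 / 2) ^ (j + 2)

lemma dyadicRadius_pos (j : ℕ) : 0 < dyadicRadius j := by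
  unfold dyadicRadius; positivity

lemma dyadicRadius_le (j : ℕ) : dyadicRadius j ≤ 1 / 4 := by
  unfold dyadicRadius
  rw [pow_add]
  have : ((1 : ℝ) / 2) ^ j ≤ 1 := pow_le_one₀ (by norm_num) (by norm_num)
  linarith

lemma tendsto_dyadicRadius : Tendsto dyadicRadius atTop (𝓝 0) :=
  (tendsto_pow_atTop_nhds_zero_of_lt_one (by norm_num) (by norm_num)).comp (tendsto_add_atTop_nat 2)

lemma tendsto_dyadicRadius_rpow {t : ℝ} (ht : 0 < t) :
    Tendsto (fun j => dyadicRadius j ^ t) atTop (𝓝 0) := by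
  have := tendsto_dyadicRadius.rpow_const (p := t) (Or.inr ht.le)
  rwa [Real.zero_rpow ht.ne'] at this

lemma exists_dyadicRadius_near {d : ℝ} (hd : 0 < d) (hd' : d ≤ dyadicRadius 0) :
    ∃ j, d ≤ dyadicRadius j ∧ dyadicRadius j ≤ 2 * d := by
  obtain ⟨n, hn, hn'⟩ := exists_nat_pow_near_of_lt_one (x := 4 * d) (y := (1 / 2 : ℝ)) (by linarith)
    (by unfold dyadicRadius at hd'; norm_num at hd'; linarith) (by norm_num) (by norm_num)
  refine ⟨n, ?_, ?_⟩ <;> unfold dyadicRadius <;> rw [pow_add]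
  · linarith
  · rw [pow_succ] at hn; linarith

/-- A mass distribution principle in which the upper bound on the measure is only tested on balls
centred in finite nets. -/
theorem le_dimH_of_measure_closedBall_le {X : Type*} [MetricSpace X] [MeasurableSpace X]
    [BorelSpace X] {μ : Measure X} {S Q : Set X} {t D : ℝ} (ht : 0 < t) (hD0 : 0 ≤ D)
    (hμS : μ S ≠ 0) (hQ : μ Qᶜ = 0) {N : ℕ → Set X}
    (hN : ∀ j, ∀ x ∈ Q, ∃ y ∈ N j, dist x y ≤ dyadicRadius j)
    (hD : ∀ j, ∀ y ∈ N j,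
      μ (closedBall y (3 * dyadicRadius j)) ≤ ENNReal.ofReal (D * dyadicRadius j ^ t)) :
    ENNReal.ofReal t ≤ dimH S := by
  have key : ∀ s : Set X, ∀ j, Metric.ediam s ≤ ENNReal.ofReal (dyadicRadius j) →
      μ s ≤ ENNReal.ofReal (D * dyadicRadius j ^ t) := by
    intro s j hs
    rcases (s ∩ Q).eq_empty_or_nonempty with h | ⟨x, hxs, hxQ⟩
    · have : μ s ≤ μ Qᶜ :=
        measure_mono fun y hy hyQ => (Set.eq_empty_iff_forall_notMem.1 h) y ⟨hy, hyQ⟩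
      rw [hQ] at this
      exact this.trans bot_le
    · obtain ⟨y, hyN, hxy⟩ := hN j x hxQ
      refine (measure_mono fun z hz => ?_).trans (hD j y hyN)
      have h1 : edist z x ≤ ENNReal.ofReal (dyadicRadius j) :=
        (Metric.edist_le_ediam_of_mem hz hxs).trans hs
      rw [edist_dist, ENNReal.ofReal_le_ofReal_iff (dyadicRadius_pos j).le] at h1
      have := dist_triangle z x y
      have := dyadicRadius_pos j
      rw [mem_closedBall]
      linarith
  set C : ENNReal := ENNReal.ofReal (D * 2 ^ t) + 1 with hC
  have hC0 : C ≠ 0 := by simp [hC]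
  have hCt : C ≠ ⊤ := by simp [hC]
  have main : C⁻¹ • μ ≤ μH[t] := by
    refine Measure.le_hausdorffMeasure t _ (ENNReal.ofReal (dyadicRadius 0))
      (by simpa using dyadicRadius_pos 0) fun s hs => ?_
    rw [Measure.smul_apply, smul_eq_mul, ENNReal.inv_mul_le_iff hC0 hCt]
    rcases eq_or_ne (Metric.ediam s) 0 with h0 | h0
    · have hlim : Tendsto (fun j => ENNReal.ofReal (D * dyadicRadius j ^ t)) atTop (𝓝 0) := by
        have := ENNReal.tendsto_ofReal ((tendsto_dyadicRadius_rpow ht).const_mul D)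
        simpa using this
      have : μ s ≤ 0 := ge_of_tendsto' hlim fun j => key s j (by simp [h0])
      exact this.trans bot_le
    · have hfin : Metric.ediam s ≠ ⊤ := ne_top_of_le_ne_top ENNReal.ofReal_ne_top hs
      set d := (Metric.ediam s).toReal with hd
      have hdpos : 0 < d := ENNReal.toReal_pos h0 hfin
      have hsd : Metric.ediam s = ENNReal.ofReal d := (ENNReal.ofReal_toReal hfin).symm
      rw [hsd, ENNReal.ofReal_le_ofReal_iff (dyadicRadius_pos 0).le] at hs
      obtain ⟨j, hj, hj'⟩ := exists_dyadicRadius_near hdpos hs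
      refine (key s j (by rw [hsd]; exact ENNReal.ofReal_le_ofReal hj)).trans ?_
      rw [hsd, ENNReal.ofReal_rpow_of_pos hdpos]
      calc ENNReal.ofReal (D * dyadicRadius j ^ t) ≤ ENNReal.ofReal (D * 2 ^ t * d ^ t) := by
            apply ENNReal.ofReal_le_ofReal
            rw [mul_assoc, ← Real.mul_rpow (by norm_num) hdpos.le]
            exact mul_le_mul_of_nonneg_left
              (Real.rpow_le_rpow (dyadicRadius_pos j).le hj' ht.le) hD0
        _ = ENNReal.ofReal (D * 2 ^ t) * ENNReal.ofReal (d ^ t) :=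
            ENNReal.ofReal_mul (by positivity)
        _ ≤ C * ENNReal.ofReal (d ^ t) := by gcongr; exact le_self_add
  apply le_dimH_of_hausdorffMeasure_ne_zero
  intro h0
  rw [Real.coe_toNNReal t ht.le] at h0
  have := (Measure.le_iff'.1 main) S
  rw [h0, Measure.smul_apply, smul_eq_mul, nonpos_iff_eq_zero, mul_eq_zero] at this
  rcases this with h | h
  · exact hCt (ENNReal.inv_eq_zero.1 h)
  · exact hμS h

/-- A continuous cut-off equal to `1` on `closedBall y (3 * r)` and to `0` off
`closedBall y (4 * r)`. -/
noncomputable def cutoff {X : Type*} [MetricSpace X] (y : X) (r : ℝ) (z : X) : ℝ :=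
  max 0 (min 1 (4 - dist z y / r))

section cutoff

variable {X : Type*} [MetricSpace X] (y : X) (r : ℝ)

lemma continuous_cutoff : Continuous (cutoff y r) := by
  unfold cutoff; fun_prop

lemma cutoff_nonneg (z : X) : 0 ≤ cutoff y r z := le_max_left _ _

lemma cutoff_le_one (z : X) : cutoff y r z ≤ 1 := by
  unfold cutoff; exact max_le zero_le_one (min_le_left _ _)

variable {r}

lemma cutoff_eq_one (hr : 0 < r) {z : X} (hz : z ∈ closedBall y (3 * r)) : cutoff y r z = 1 := by
  have : dist z y / r ≤ 3 := (div_le_iff₀ hr).2 hz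
  unfold cutoff
  rw [min_eq_left (by linarith), max_eq_right zero_le_one]

lemma cutoff_eq_zero (hr : 0 < r) {z : X} (hz : z ∉ closedBall y (4 * r)) : cutoff y r z = 0 := by
  have : 4 ≤ dist z y / r := (le_div_iff₀ hr).2 (not_le.1 hz).le
  unfold cutoff
  exact max_eq_left ((min_le_right _ _).trans (by linarith))

end cutoff

lemma integrable_of_continuous_of_isCompact {X : Type*} [MetricSpace X] [MeasurableSpace X]
    [BorelSpace X] {ν : Measure X} [IsFiniteMeasureOnCompacts ν] {Q : Set X} (hQ : IsCompact Q)
    {g : X → ℝ} (hg : Continuous g) (hgQ : ∀ x ∉ Q, g x = 0) : Integrable g ν :=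
  hg.integrable_of_hasCompactSupport (HasCompactSupport.intro hQ hgQ)

/-- A weak limit of densities whose supports shrink to `⋂ i, K i` gives a lower bound for the
Hausdorff dimension of that intersection. -/
theorem le_dimH_iInter_of_densities {X : Type*} [MetricSpace X] [MeasurableSpace X]
    [BorelSpace X] {ν : Measure X} [IsFiniteMeasureOnCompacts ν] {Q : Set X} (hQ : IsCompact Q)
    {K : ℕ → Set X} (hK : ∀ i, IsClosed (K i)) {t D a b : ℝ} (ht : 0 < t) (hD0 : 0 ≤ D)
    (ha : 0 < a) {N : ℕ → Set X}
    (hN : ∀ j, ∀ x ∈ Q, ∃ y ∈ N j, dist x y ≤ dyadicRadius j)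
    {θ : ℕ → X → ℝ} (hθc : ∀ k, Continuous (θ k)) (hθ0 : ∀ k x, 0 ≤ θ k x)
    (hθQ : ∀ k, ∀ x ∉ Q, θ k x = 0) (hθK : ∀ i k, i < k → ∀ x ∉ K i, θ k x = 0)
    (hθa : ∀ k, a ≤ ∫ x, θ k x ∂ν) (hθb : ∀ k, ∫ x, θ k x ∂ν ≤ b)
    (hD : ∀ k j, ∀ y ∈ N j,
      ∫ x, θ k x * cutoff y (dyadicRadius j) x ∂ν ≤ D * dyadicRadius j ^ t) :
    ENNReal.ofReal t ≤ dimH (⋂ i, K i) := by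
  have hInt : ∀ k, Integrable (θ k) ν := fun k =>
    integrable_of_continuous_of_isCompact hQ (hθc k) (hθQ k)
  have hfin : ∀ k, IsFiniteMeasure (ν.withDensity fun x => ENNReal.ofReal (θ k x)) := fun k =>
    isFiniteMeasure_withDensity_ofReal (hInt k).2
  let P : ℕ → FiniteMeasure X := fun k =>
    ⟨ν.withDensity fun x => ENNReal.ofReal (θ k x), hfin k⟩
  have hPint : ∀ k (g : X → ℝ), ∫ x, g x ∂(P k : Measure X) = ∫ x, θ k x * g x ∂ν := by
    intro k g
    change ∫ x, g x ∂(ν.withDensity fun x => ENNReal.ofReal (θ k x)) = _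
    rw [integral_withDensity_eq_integral_toReal_smul
      (hθc k).measurable.ennreal_ofReal (by simp)]
    simp [ENNReal.toReal_ofReal (hθ0 k _)]
  have hPmass : ∀ k, ((P k).mass : ℝ) = ∫ x, θ k x ∂ν := by
    intro k
    have := hPint k fun _ => 1
    simp only [mul_one] at this
    rw [← this]
    simp [FiniteMeasure.mass, Measure.real]
    rfl
  have hPzero : ∀ k (U : Set X), MeasurableSet U → (∀ x ∈ U, θ k x = 0) → (P k) U = 0 := by
    intro k U hU h
    rw [FiniteMeasure.null_iff_toMeasure_null]
    change (ν.withDensity fun x => ENNReal.ofReal (θ k x)) U = 0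
    rw [withDensity_apply _ hU, lintegral_eq_zero_iff (hθc k).measurable.ennreal_ofReal]
    refine (ae_restrict_iff' hU).2 (Eventually.of_forall fun x hx => ?_)
    simp [h x hx]
  have hcpt : ∀ F : Set X, IsCompact F →
      IsCompact {μ : FiniteMeasure X | μ.mass ≤ b.toNNReal ∧ μ Fᶜ = 0} := fun F hF =>
    isCompact_setOfPred_finiteMeasure_le_of_isCompact _ hF
  have hmem : ∀ k, (P k).mass ≤ b.toNNReal := by
    intro k
    rw [← NNReal.coe_le_coe, hPmass, Real.coe_toNNReal _ ((ha.le.trans (hθa k)).trans (hθb k))]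
    exact hθb k
  obtain ⟨μ, hμ, hlim⟩ := (hcpt Q hQ).ultrafilter_le_nhds
    ((hyperfilter ℕ).map P) (by
      rw [le_principal_iff]
      exact Filter.mem_map.2 (Eventually.of_forall fun k =>
        ⟨hmem k, hPzero k _ hQ.measurableSet.compl fun x hx => hθQ k x hx⟩))
  have hlim' : Tendsto P (hyperfilter ℕ) (𝓝 μ) := hlim
  have hμK : ∀ i, μ (K i)ᶜ = 0 := by
    intro i
    have hc := hcpt (Q ∩ K i) (hQ.inter_right (hK i))
    have : μ ∈ {μ : FiniteMeasure X | μ.mass ≤ b.toNNReal ∧ μ (Q ∩ K i)ᶜ = 0} := by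
      refine hc.isClosed.mem_of_tendsto hlim' ?_
      have hev : ∀ᶠ k in (hyperfilter ℕ : Filter ℕ), i < k :=
        Filter.Eventually.filter_mono (Nat.hyperfilter_le_atTop) (eventually_gt_atTop i)
      filter_upwards [hev] with k hk
      refine ⟨hmem k, hPzero k _ (hQ.measurableSet.inter (hK i).measurableSet).compl ?_⟩
      intro x hx
      by_cases hxQ : x ∈ Q
      · exact hθK i k hk x fun hxK => hx ⟨hxQ, hxK⟩
      · exact hθQ k x hxQ
    have h2 := this.2
    exact le_antisymm ((FiniteMeasure.apply_mono _
      (Set.compl_subset_compl.2 Set.inter_subset_right)).trans h2.le) bot_le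
  have hμK' : (μ : Measure X) (⋂ i, K i)ᶜ = 0 := by
    rw [Set.compl_iInter]
    exact measure_iUnion_null fun i => (FiniteMeasure.null_iff_toMeasure_null _ _).1 (hμK i)
  have hmass : a ≤ μ.mass := by
    have h1 : Tendsto (fun k => ((P k).mass : ℝ)) (hyperfilter ℕ) (𝓝 (μ.mass : ℝ)) :=
      (NNReal.continuous_coe.tendsto _).comp
        ((FiniteMeasure.continuous_mass.tendsto μ).comp hlim')
    exact ge_of_tendsto' h1 fun k => (hPmass k).symm ▸ hθa k
  refine le_dimH_of_measure_closedBall_le (μ := (μ : Measure X)) (Q := Q) (D := D) (N := N) ht hD0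
    ?_ ((FiniteMeasure.null_iff_toMeasure_null _ _).1 hμ.2) hN ?_
  · intro h0
    have : (μ : Measure X) Set.univ = 0 := by
      rw [← Set.union_compl_self (⋂ i, K i)]
      exact measure_union_null h0 hμK'
    have h1 : μ.mass = 0 := (FiniteMeasure.null_iff_toMeasure_null _ _).2 this
    rw [h1] at hmass
    simp at hmass
    linarith
  · intro j y hy
    have hr := dyadicRadius_pos j
    let g : BoundedContinuousFunction X ℝ :=
      BoundedContinuousFunction.ofNormedAddCommGroup (cutoff y (dyadicRadius j))
        (continuous_cutoff y _) 1 fun z => by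
          rw [Real.norm_of_nonneg (cutoff_nonneg _ _ _)]; exact cutoff_le_one _ _ _
    have hg : Tendsto (fun k => ∫ x, g x ∂(P k : Measure X)) (hyperfilter ℕ)
        (𝓝 (∫ x, g x ∂(μ : Measure X))) :=
      (FiniteMeasure.tendsto_iff_forall_integral_tendsto.1 hlim') g
    have hle : ∫ x, g x ∂(μ : Measure X) ≤ D * dyadicRadius j ^ t :=
      le_of_tendsto' hg fun k => by rw [hPint]; exact hD k j y hy
    have hgi : Integrable g (μ : Measure X) := g.integrable _
    calc (μ : Measure X) (closedBall y (3 * dyadicRadius j))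
        = ∫⁻ x in closedBall y (3 * dyadicRadius j), 1 ∂(μ : Measure X) := by simp
      _ ≤ ∫⁻ x in closedBall y (3 * dyadicRadius j), ENNReal.ofReal (g x) ∂(μ : Measure X) := by
          refine setLIntegral_mono' measurableSet_closedBall fun x hx => ?_
          change 1 ≤ ENNReal.ofReal (cutoff y (dyadicRadius j) x)
          rw [cutoff_eq_one y hr hx]; simp
      _ ≤ ∫⁻ x, ENNReal.ofReal (g x) ∂(μ : Measure X) := setLIntegral_le_lintegral _ _
      _ = ENNReal.ofReal (∫ x, g x ∂(μ : Measure X)) :=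
          (ofReal_integral_eq_lintegral_ofReal hgi
            (Eventually.of_forall fun x => cutoff_nonneg _ _ _)).symm
      _ ≤ _ := ENNReal.ofReal_le_ofReal hle

/-- If the continuous densities `f n` converge weakly to the reference measure on `Q` and are
uniformly `s`-regular from above, then the points lying in infinitely many of the supports of the
`f n` form a set of Hausdorff dimension at least `s`. -/
theorem le_dimH_frequently_of_densities {X : Type*} [MetricSpace X] [ProperSpace X]
    [MeasurableSpace X] [BorelSpace X] {ν : Measure X} [IsFiniteMeasureOnCompacts ν] {Q : Set X}
    (hQ : IsCompact Q) {f : ℕ → X → ℝ} (hfc : ∀ n, Continuous (f n)) (hf0 : ∀ n x, 0 ≤ f n x)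
    {K : ℕ → Set X} (hK : ∀ n, IsClosed (K n)) (hfK : ∀ n, ∀ x ∉ K n, f n x = 0) {s C : ℝ}
    (hC : 0 ≤ C)
    (hs : ∀ n x r, 0 < r → r ≤ 1 → ∫ y in closedBall x r, f n y ∂ν ≤ C * r ^ s)
    (hw : ∀ g : X → ℝ, Continuous g → (∀ x ∉ Q, g x = 0) →
      Tendsto (fun n => ∫ x, g x * f n x ∂ν) atTop (𝓝 (∫ x, g x ∂ν)))
    {χ : X → ℝ} (hχc : Continuous χ) (hχ0 : ∀ x, 0 ≤ χ x) (hχQ : ∀ x ∉ Q, χ x = 0)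
    (hχ : 0 < ∫ x, χ x ∂ν) :
    ENNReal.ofReal s ≤ dimH {x | ∃ᶠ n in atTop, x ∈ K n} := by
  suffices h : ∀ t : ℝ, 0 < t → t < s →
      ENNReal.ofReal t ≤ dimH {x | ∃ᶠ n in atTop, x ∈ K n} by
    refine le_of_forall_lt fun c hc => ?_
    obtain ⟨r, hr0, hr1, hr2⟩ := ENNReal.lt_iff_exists_real_btwn.1 hc
    rcases hr0.eq_or_lt with rfl | hr0
    · simp at hr1
    · exact hr1.trans_le (h r hr0 ((ENNReal.ofReal_lt_ofReal_iff_of_nonneg hr0.le).1 hr2))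
  intro t ht hts
  have hnet : ∀ j, ∃ N : Set X, N.Finite ∧ ∀ x ∈ Q, ∃ y ∈ N, dist x y ≤ dyadicRadius j := by
    intro j
    obtain ⟨N, -, hN, hcov⟩ := finite_cover_balls_of_compact hQ (dyadicRadius_pos j)
    refine ⟨N, hN, fun x hx => ?_⟩
    obtain ⟨y, hy, hxy⟩ := Set.mem_iUnion₂.1 (hcov hx)
    exact ⟨y, hy, (mem_ball.1 hxy).le⟩
  choose N hNfin hN using hnet
  have hloc : ∀ θ : X → ℝ, Continuous θ → (∀ x, 0 ≤ θ x) → (∀ x ∉ Q, θ x = 0) →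
      ∃ M, 0 ≤ M ∧ ∀ n j y, ∫ x, θ x * f n x * cutoff y (dyadicRadius j) x ∂ν ≤
        M * dyadicRadius j ^ s := by
    intro θ hθc hθ0 hθQ
    obtain ⟨M, hM⟩ := hQ.exists_bound_of_continuousOn hθc.continuousOn
    have hM' : ∀ x, θ x ≤ |M| := fun x => by
      by_cases hx : x ∈ Q
      · exact ((Real.le_norm_self _).trans (hM x hx)).trans (le_abs_self M)
      · rw [hθQ x hx]; exact abs_nonneg M
    refine ⟨|M| * C * 4 ^ s, by positivity, fun n j y => ?_⟩
    have hr := dyadicRadius_pos j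
    have hr4 := dyadicRadius_le j
    have hInt : IntegrableOn (f n) (closedBall y (4 * dyadicRadius j)) ν :=
      (hfc n).continuousOn.integrableOn_compact (isCompact_closedBall _ _)
    calc ∫ x, θ x * f n x * cutoff y (dyadicRadius j) x ∂ν
        = ∫ x in closedBall y (4 * dyadicRadius j),
            θ x * f n x * cutoff y (dyadicRadius j) x ∂ν :=
          (setIntegral_eq_integral_of_forall_compl_eq_zero fun x hx => by
            rw [cutoff_eq_zero y hr hx, mul_zero]).symm
      _ ≤ ∫ x in closedBall y (4 * dyadicRadius j), |M| * f n x ∂ν := by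
          refine setIntegral_mono_on ?_ (hInt.const_mul _) measurableSet_closedBall fun x _ => ?_
          · exact ((hθc.mul (hfc n)).mul (continuous_cutoff y _)).continuousOn.integrableOn_compact
              (isCompact_closedBall _ _)
          · have h1 : θ x * f n x ≤ |M| * f n x := mul_le_mul_of_nonneg_right (hM' x) (hf0 n x)
            exact (mul_le_of_le_one_right (mul_nonneg (hθ0 x) (hf0 n x))
              (cutoff_le_one _ _ _)).trans h1
      _ = |M| * ∫ x in closedBall y (4 * dyadicRadius j), f n x ∂ν := integral_const_mul _ _
      _ ≤ |M| * (C * (4 * dyadicRadius j) ^ s) :=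
          mul_le_mul_of_nonneg_left (hs n y _ (by linarith) (by linarith)) (abs_nonneg M)
      _ = |M| * C * 4 ^ s * dyadicRadius j ^ s := by
          rw [Real.mul_rpow (by norm_num) hr.le]; ring
  have hrpow : ∀ j, dyadicRadius j ^ s ≤ dyadicRadius j ^ t := fun j =>
    Real.rpow_le_rpow_of_exponent_ge (dyadicRadius_pos j) (by linarith [dyadicRadius_le j]) hts.le
  have hcut : ∀ θ : X → ℝ, Continuous θ → (∀ x ∉ Q, θ x = 0) → ∀ j y,
      Tendsto (fun n => ∫ x, θ x * f n x * cutoff y (dyadicRadius j) x ∂ν) atTop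
        (𝓝 (∫ x, θ x * cutoff y (dyadicRadius j) x ∂ν)) := by
    intro θ hθc hθQ j y
    have := hw (fun x => θ x * cutoff y (dyadicRadius j) x) (hθc.mul (continuous_cutoff y _))
      fun x hx => by rw [hθQ x hx, zero_mul]
    simpa only [mul_right_comm] using this
  obtain ⟨M₀, hM₀, hbase⟩ := hloc χ hχc hχ0 hχQ
  set a := (∫ x, χ x ∂ν) / 2 with ha
  set b := (∫ x, χ x ∂ν) + 1 with hb
  set D := M₀ + 1 with hD
  let Good : (X → ℝ) → Prop := fun θ => Continuous θ ∧ (∀ x, 0 ≤ θ x) ∧ (∀ x ∉ Q, θ x = 0) ∧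
    a < ∫ x, θ x ∂ν ∧ ∫ x, θ x ∂ν < b ∧ ∃ D', 0 ≤ D' ∧ D' < D ∧ ∀ j, ∀ y ∈ N j,
      ∫ x, θ x * cutoff y (dyadicRadius j) x ∂ν ≤ D' * dyadicRadius j ^ t
  have hgood0 : Good χ := by
    refine ⟨hχc, hχ0, hχQ, by linarith, by linarith, M₀, hM₀, by linarith, fun j y _ => ?_⟩
    exact le_of_tendsto' (hcut χ hχc hχQ j y) fun n => (hbase n j y).trans
      (mul_le_mul_of_nonneg_left (hrpow j) hM₀)
  have hstep : ∀ θ, Good θ → ∀ m, ∃ n, m < n ∧ Good fun x => θ x * f n x := by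
    rintro θ ⟨hθc, hθ0, hθQ, hθa, hθb, D', hD'0, hD', hθD⟩ m
    obtain ⟨M, hM, hMle⟩ := hloc θ hθc hθ0 hθQ
    have hsmall : ∃ j₀, ∀ j ≥ j₀, M * dyadicRadius j ^ s ≤ (D' + D) / 2 * dyadicRadius j ^ t := by
      have h1 : Tendsto (fun j => M * dyadicRadius j ^ (s - t)) atTop (𝓝 0) := by
        simpa using (tendsto_dyadicRadius_rpow (sub_pos.2 hts)).const_mul M
      obtain ⟨j₀, hj₀⟩ := eventually_atTop.1
        (h1.eventually (eventually_le_nhds (show (0 : ℝ) < (D' + D) / 2 by linarith)))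
      refine ⟨j₀, fun j hj => ?_⟩
      have h2 : dyadicRadius j ^ s = dyadicRadius j ^ (s - t) * dyadicRadius j ^ t := by
        rw [← Real.rpow_add (dyadicRadius_pos j), sub_add_cancel]
      rw [h2, ← mul_assoc]
      exact mul_le_mul_of_nonneg_right (hj₀ j hj) (Real.rpow_nonneg (dyadicRadius_pos j).le _)
    obtain ⟨j₀, hj₀⟩ := hsmall
    have hev : ∀ᶠ n in atTop, ∀ j ∈ Set.Iio j₀, ∀ y ∈ N j,
        ∫ x, θ x * f n x * cutoff y (dyadicRadius j) x ∂ν ≤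
          (D' + D) / 2 * dyadicRadius j ^ t := by
      rw [Filter.eventually_all_finite (Set.finite_Iio j₀)]
      intro j _
      rw [Filter.eventually_all_finite (hNfin j)]
      intro y hy
      refine (hcut θ hθc hθQ j y).eventually (eventually_le_nhds ?_)
      refine (hθD j y hy).trans_lt ?_
      exact mul_lt_mul_of_pos_right (by linarith) (Real.rpow_pos_of_pos (dyadicRadius_pos j) _)
    have hmass := hw θ hθc hθQ
    obtain ⟨n, hn1, hn2, hn3, hn4⟩ := (hev.and ((hmass.eventually (lt_mem_nhds hθa)).and
      ((hmass.eventually (gt_mem_nhds hθb)).and (eventually_gt_atTop m)))).exists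
    refine ⟨n, hn4, hθc.mul (hfc n), fun x => mul_nonneg (hθ0 x) (hf0 n x),
      fun x hx => by simp [hθQ x hx], hn2, hn3, (D' + D) / 2, by linarith, by linarith,
      fun j y hy => ?_⟩
    rcases lt_or_ge j j₀ with hj | hj
    · exact hn1 j hj y hy
    · exact (hMle n j y).trans (hj₀ j hj)
  choose! nxt hnxt hnxtGood using hstep
  let st : ℕ → ℕ × (X → ℝ) := fun k =>
    Nat.rec (0, χ) (fun _ p => (nxt p.2 p.1, fun x => p.2 x * f (nxt p.2 p.1) x)) k
  have hst : ∀ k, st (k + 1) =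
      (nxt (st k).2 (st k).1, fun x => (st k).2 x * f (nxt (st k).2 (st k).1) x) := fun _ => rfl
  have hstG : ∀ k, Good (st k).2 := by
    intro k
    induction k with
    | zero => exact hgood0
    | succ k ih => rw [hst]; exact hnxtGood _ ih _
  have hmono : StrictMono fun k => (st k).1 :=
    strictMono_nat_of_lt_succ fun k => by rw [hst]; exact hnxt _ (hstG k) _
  have hmul : ∀ k x, (st (k + 1)).2 x = (st k).2 x * f (st (k + 1)).1 x := fun k x => by
    rw [hst]
  have hzero : ∀ i k, i < k → ∀ x ∉ K (st (i + 1)).1, (st k).2 x = 0 := by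
    intro i k hik x hx
    induction k with
    | zero => omega
    | succ k ih =>
      rw [hmul]
      rcases Nat.lt_succ_iff_lt_or_eq.1 hik with h | rfl
      · rw [ih h, zero_mul]
      · rw [hfK _ x hx, mul_zero]
  refine (le_dimH_iInter_of_densities (ν := ν) hQ (K := fun i => K (st (i + 1)).1)
    (fun i => hK _) (D := D) (a := a) (b := b) (N := N) (θ := fun k => (st k).2) ht
    (by linarith) (by linarith) hN
    (fun k => (hstG k).1) (fun k => (hstG k).2.1) (fun k => (hstG k).2.2.1) hzero
    (fun k => (hstG k).2.2.2.1.le) (fun k => (hstG k).2.2.2.2.1.le) fun k j y hy => ?_).trans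
    (dimH_mono fun x hx => ?_)
  · obtain ⟨D', -, hD', h⟩ := (hstG k).2.2.2.2.2
    exact (h j y hy).trans (mul_le_mul_of_nonneg_right hD'.le
      (Real.rpow_nonneg (dyadicRadius_pos j).le _))
  · rw [Set.mem_iInter] at hx
    refine Filter.frequently_atTop.2 fun m => ⟨(st (m + 1)).1, ?_, hx m⟩
    exact ((hmono.id_le m).trans (hmono (Nat.lt_succ_self m)).le)

/-- Sums of bumps, one for each cell of a partition of mesh tending to `0` and of the same mass as
the cell, converge weakly to the reference measure. -/
theorem tendsto_integral_mul_sum_bumps {X ι : Type*} [MetricSpace X] [ProperSpace X]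
    [MeasurableSpace X] [BorelSpace X] {ν : Measure X} [IsFiniteMeasureOnCompacts ν] {Q : Set X}
    (hQ : IsCompact Q) {W : ℕ → Finset ι} {cell : ℕ → ι → Set X} {β : ℕ → ι → X → ℝ}
    {p : ℕ → ι → X} {δ : ℕ → ℝ} {B : ℝ} (hδ : Tendsto δ atTop (𝓝 0))
    (hcm : ∀ n i, MeasurableSet (cell n i)) (hcd : ∀ n, Pairwise (Function.onFun Disjoint (cell n)))
    (hcov : ∀ n, Q ⊆ ⋃ i ∈ W n, cell n i) (hcp : ∀ n i, cell n i ⊆ closedBall (p n i) (δ n))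
    (hβc : ∀ n i, Continuous (β n i)) (hβ0 : ∀ n i x, 0 ≤ β n i x)
    (hβp : ∀ n i, ∀ x ∉ closedBall (p n i) (δ n), β n i x = 0)
    (hβi : ∀ n i, ∫ x, β n i x ∂ν = ν.real (cell n i))
    (hB : ∀ n, ∑ i ∈ W n, ν.real (cell n i) ≤ B)
    {g : X → ℝ} (hg : Continuous g) (hgQ : ∀ x ∉ Q, g x = 0) :
    Tendsto (fun n => ∫ x, g x * ∑ i ∈ W n, β n i x ∂ν) atTop (𝓝 (∫ x, g x ∂ν)) := by
  have hgi : Integrable g ν := integrable_of_continuous_of_isCompact hQ hg hgQ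
  have huc : UniformContinuous g :=
    HasCompactSupport.uniformContinuous_of_continuous (HasCompactSupport.intro hQ hgQ) hg
  have hfin : ∀ n i, ν (cell n i) ≠ ⊤ := fun n i =>
    ne_top_of_le_ne_top (isCompact_closedBall _ _).measure_lt_top.ne (measure_mono (hcp n i))
  have hβint : ∀ n i, Integrable (β n i) ν := fun n i =>
    integrable_of_continuous_of_isCompact (isCompact_closedBall _ _) (hβc n i) (hβp n i)
  have hgβ : ∀ n i, Integrable (fun x => g x * β n i x) ν := fun n i =>
    integrable_of_continuous_of_isCompact hQ (hg.mul (hβc n i)) fun x hx => by simp [hgQ x hx]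
  have hB0 : 0 ≤ B := (Finset.sum_nonneg fun i _ => measureReal_nonneg).trans (hB 0)
  rw [Metric.tendsto_atTop]
  intro e he
  obtain ⟨η, hη, hgη⟩ := Metric.uniformContinuous_iff.1 huc (e / (2 * (B + 1))) (by positivity)
  obtain ⟨n₀, hn₀⟩ := eventually_atTop.1 (hδ.eventually (gt_mem_nhds hη))
  refine ⟨n₀, fun n hn => ?_⟩
  have hclose : ∀ i, ∀ x ∈ closedBall (p n i) (δ n), |g x - g (p n i)| ≤ e / (2 * (B + 1)) :=
    fun i x hx => (hgη ((mem_closedBall.1 hx).trans_lt (hn₀ n hn))).le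
  have h1 : ∫ x, g x * ∑ i ∈ W n, β n i x ∂ν = ∑ i ∈ W n, ∫ x, g x * β n i x ∂ν := by
    simp_rw [Finset.mul_sum]
    exact integral_finsetSum _ fun i _ => hgβ n i
  have h2 : ∫ x, g x ∂ν = ∑ i ∈ W n, ∫ x in cell n i, g x ∂ν := by
    rw [← integral_biUnion_finset _ (fun i _ => hcm n i) (fun i _ j _ hij => hcd n hij)
      (fun i _ => hgi.integrableOn)]
    exact (setIntegral_eq_integral_of_forall_compl_eq_zero fun x hx =>
      hgQ x fun hxQ => hx (hcov n hxQ)).symm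
  have hβd : ∀ i, |∫ x, g x * β n i x ∂ν - g (p n i) * ν.real (cell n i)| ≤
      e / (2 * (B + 1)) * ν.real (cell n i) := by
    intro i
    rw [← hβi, ← integral_const_mul, ← integral_const_mul,
      ← integral_sub (hgβ n i) ((hβint n i).const_mul _),
      ← Real.norm_eq_abs]
    refine norm_integral_le_of_norm_le ((hβint n i).const_mul _) (Eventually.of_forall fun x => ?_)
    rw [← sub_mul, norm_mul, Real.norm_of_nonneg (hβ0 n i x)]
    by_cases hx : x ∈ closedBall (p n i) (δ n)
    · exact mul_le_mul_of_nonneg_right (hclose i x hx) (hβ0 n i x)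
    · simp [hβp n i x hx]
  have hcd' : ∀ i, |∫ x in cell n i, g x ∂ν - g (p n i) * ν.real (cell n i)| ≤
      e / (2 * (B + 1)) * ν.real (cell n i) := by
    intro i
    have h3 : g (p n i) * ν.real (cell n i) = ∫ _ in cell n i, g (p n i) ∂ν := by
      rw [setIntegral_const, smul_eq_mul, mul_comm]
    rw [h3, ← integral_sub hgi.integrableOn (integrableOn_const (hfin n i)),
      ← Real.norm_eq_abs]
    exact norm_setIntegral_le_of_norm_le_const (hfin n i).lt_top
      fun x hx => hclose i x (hcp n i hx)
  rw [Real.dist_eq, h1, h2, ← Finset.sum_sub_distrib]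
  calc |∑ i ∈ W n, (∫ x, g x * β n i x ∂ν - ∫ x in cell n i, g x ∂ν)|
      ≤ ∑ i ∈ W n, |∫ x, g x * β n i x ∂ν - ∫ x in cell n i, g x ∂ν| :=
        Finset.abs_sum_le_sum_abs _ _
    _ ≤ ∑ i ∈ W n, 2 * (e / (2 * (B + 1))) * ν.real (cell n i) := by
        refine Finset.sum_le_sum fun i _ => ?_
        have h3 := abs_le.1 (hβd i)
        have h4 := abs_le.1 (hcd' i)
        rw [abs_le]
        constructor <;> linarith
    _ = e / (B + 1) * ∑ i ∈ W n, ν.real (cell n i) := by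
        rw [← Finset.mul_sum]; congr 1; field_simp
    _ ≤ e / (B + 1) * B := mul_le_mul_of_nonneg_left (hB n) (by positivity)
    _ < e := by
        rw [div_mul_eq_mul_div, div_lt_iff₀ (by linarith)]
        nlinarith

/-- The tent function of width `w`, height `1 / w` and integral `1` centred at `p`. -/
noncomputable def tent (w p x : ℝ) : ℝ := max 0 (1 - |(x - p) / w|) / w

lemma continuous_tent (w p : ℝ) : Continuous (tent w p) := by unfold tent; fun_prop

section tent

variable {w : ℝ}

lemma tent_nonneg (hw : 0 < w) (p x : ℝ) : 0 ≤ tent w p x :=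
  div_nonneg (le_max_left _ _) hw.le

lemma tent_le (hw : 0 < w) (p x : ℝ) : tent w p x ≤ 1 / w :=
  div_le_div_of_nonneg_right (max_le zero_le_one (by linarith [abs_nonneg ((x - p) / w)])) hw.le

lemma tent_eq_zero (hw : 0 < w) (p : ℝ) {x : ℝ} (hx : w < |x - p|) : tent w p x = 0 := by
  have : 1 ≤ |(x - p) / w| := by
    rw [abs_div, abs_of_pos hw, le_div_iff₀ hw]; linarith
  unfold tent
  rw [max_eq_left (by linarith), zero_div]

lemma integrable_tent (hw : 0 < w) (p : ℝ) : Integrable (tent w p) := by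
  refine integrable_of_continuous_of_isCompact (isCompact_closedBall p w) (continuous_tent w p)
    fun x hx => tent_eq_zero hw p ?_
  simpa [Real.dist_eq] using hx

lemma integral_tent (hw : 0 < w) (p : ℝ) : ∫ x, tent w p x = 1 := by
  have h1 : ∫ x, tent w p x = ∫ x : ℝ, max 0 (1 - |x|) := by
    unfold tent
    rw [integral_div, integral_sub_right_eq_self (fun x => max 0 (1 - |x / w|)) p,
      Measure.integral_comp_div (fun x => max 0 (1 - |x|)) w, abs_of_pos hw, smul_eq_mul,
      mul_div_cancel_left₀ _ hw.ne']
  have h2 : ∫ x : ℝ, max 0 (1 - |x|) = ∫ x in Set.Ioc (-1 : ℝ) 1, max 0 (1 - |x|) := by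
    refine (setIntegral_eq_integral_of_forall_compl_eq_zero fun x hx => ?_).symm
    rw [max_eq_left]
    by_contra h
    have := abs_lt.1 (show |x| < 1 by linarith)
    exact hx ⟨this.1, this.2.le⟩
  have h3 : ∫ x in (-1 : ℝ)..1, max 0 (1 - |x|) =
      (∫ x in (-1 : ℝ)..0, (1 + x)) + ∫ x in (0 : ℝ)..1, (1 - x) := by
    rw [← intervalIntegral.integral_add_adjacent_intervals (b := 0)
      (Continuous.intervalIntegrable (by fun_prop) _ _)
      (Continuous.intervalIntegrable (by fun_prop) _ _)]
    congr 1
    · refine intervalIntegral.integral_congr fun x hx => ?_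
      rw [Set.uIcc_of_le (by norm_num)] at hx
      simp only [abs_of_nonpos hx.2]
      rw [max_eq_right (by linarith [hx.1])]; ring
    · refine intervalIntegral.integral_congr fun x hx => ?_
      rw [Set.uIcc_of_le (by norm_num)] at hx
      simp only [abs_of_nonneg hx.1]
      rw [max_eq_right (by linarith [hx.2])]
  rw [h1, h2, ← intervalIntegral.integral_of_le (by norm_num), h3]
  rw [intervalIntegral.integral_add (by simp) (by simp), intervalIntegral.integral_sub (by simp)
    (by simp)]
  simp [integral_id]
  norm_num

lemma setIntegral_tent_nonneg (hw : 0 < w) (p x r : ℝ) :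
    0 ≤ ∫ y in closedBall x r, tent w p y :=
  setIntegral_nonneg measurableSet_closedBall fun y _ => tent_nonneg hw p y

lemma setIntegral_tent_le_one (hw : 0 < w) (p x r : ℝ) :
    ∫ y in closedBall x r, tent w p y ≤ 1 := by
  rw [← integral_tent hw p]
  exact setIntegral_le_integral (integrable_tent hw p)
    (Eventually.of_forall fun y => tent_nonneg hw p y)

lemma setIntegral_tent_le (hw : 0 < w) (p : ℝ) {x r : ℝ} (hr : 0 < r) :
    ∫ y in closedBall x r, tent w p y ≤ 2 * r / w := by
  calc ∫ y in closedBall x r, tent w p y ≤ ∫ _ in closedBall x r, 1 / w :=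
        setIntegral_mono_on (integrable_tent hw p).integrableOn
          (integrableOn_const (isCompact_closedBall _ _).measure_lt_top.ne)
          measurableSet_closedBall fun y _ => tent_le hw p y
    _ = 2 * r / w := by
        rw [setIntegral_const, Real.volume_real_closedBall hr.le, smul_eq_mul]; ring

lemma setIntegral_tent_eq_zero (hw : 0 < w) (p : ℝ) {x r : ℝ} (h : r + w < |x - p|) :
    ∫ y in closedBall x r, tent w p y = 0 := by
  refine setIntegral_eq_zero_of_forall_eq_zero fun y hy => tent_eq_zero hw p ?_
  rw [mem_closedBall, Real.dist_eq] at hy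
  have h1 := abs_sub_le x y p
  rw [abs_sub_comm x y] at h1
  linarith

end tent

/-- Integer points in a box for two linear forms whose product is bounded below. -/
lemma card_le_of_forms {U S : ℤ × ℤ → ℝ} (hU : ∀ v w, U (v - w) = U v - U w)
    (hS : ∀ v w, S (v - w) = S v - S w) (hUS : ∀ v, v ≠ 0 → 1 ≤ |U v * S v|)
    {W : Finset (ℤ × ℤ)} {u₀ s₀ α β : ℝ} (hα : 0 ≤ α) (hβ : 0 ≤ β)
    (hWU : ∀ v ∈ W, |U v - u₀| ≤ α) (hWS : ∀ v ∈ W, |S v - s₀| ≤ β) :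
    (W.card : ℝ) ≤ 4 * (α * β) + 1 := by
  have hcard : W.card ≤ (Finset.Icc (0 : ℤ) ⌊4 * (α * β)⌋).card := by
    refine Finset.card_le_card_of_injOn (fun v => ⌊(U v - u₀ + α) * (2 * β)⌋) (fun v hv => ?_) ?_
    · have h := abs_le.1 (hWU v hv)
      simp only [Finset.coe_Icc, Set.mem_Icc]
      refine ⟨Int.floor_nonneg.2 (mul_nonneg (by linarith) (by linarith)), Int.floor_le_floor ?_⟩
      nlinarith
    · intro v hv w hw hvw
      by_contra hne
      have h1 := Int.abs_sub_lt_one_of_floor_eq_floor hvw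
      have h2 : |U (v - w)| * (2 * β) < 1 := by
        have h : (U v - U w) * (2 * β) =
            (U v - u₀ + α) * (2 * β) - (U w - u₀ + α) * (2 * β) := by ring
        calc |U (v - w)| * (2 * β) = |(U v - U w) * (2 * β)| := by
              rw [hU, abs_mul, abs_of_nonneg (show 0 ≤ 2 * β by linarith)]
          _ < 1 := by rw [h]; exact h1
      have h3 : |S (v - w)| ≤ 2 * β := by
        have h4 := abs_le.1 (hWS v hv)
        have h5 := abs_le.1 (hWS w hw)
        rw [hS, abs_le]
        constructor <;> linarith
      have h6 := hUS (v - w) (sub_ne_zero.2 hne)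
      rw [abs_mul] at h6
      nlinarith [abs_nonneg (U (v - w))]
  have h0 : 0 ≤ ⌊4 * (α * β)⌋ := Int.floor_nonneg.2 (by positivity)
  rw [Int.card_Icc] at hcard
  have h1 : (W.card : ℤ) ≤ ⌊4 * (α * β)⌋ + 1 := by omega
  calc (W.card : ℝ) ≤ ((⌊4 * (α * β)⌋ + 1 : ℤ) : ℝ) := by exact_mod_cast h1
    _ ≤ _ := by push_cast; linarith [Int.floor_le (4 * (α * β))]

lemma card_le_of_abs_sub_le {W : Finset ℤ} {y α : ℝ} (hα : 0 ≤ α)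
    (hW : ∀ j ∈ W, |(j : ℝ) - y| ≤ α) : (W.card : ℝ) ≤ 2 * α + 1 := by
  have hsub : W ⊆ Finset.Icc ⌈y - α⌉ ⌊y + α⌋ := fun j hj => by
    have := abs_le.1 (hW j hj)
    exact Finset.mem_Icc.2 ⟨Int.ceil_le.2 (by linarith), Int.le_floor.2 (by linarith)⟩
  have h1 := Finset.card_le_card hsub
  rw [Int.card_Icc] at h1
  have h2 : (W.card : ℤ) ≤ max (⌊y + α⌋ + 1 - ⌈y - α⌉) 0 := by
    rw [← Int.toNat_eq_max]; exact_mod_cast h1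
  have h3 : (W.card : ℝ) ≤ max ((⌊y + α⌋ : ℝ) + 1 - ⌈y - α⌉) 0 := by exact_mod_cast h2
  refine h3.trans (max_le ?_ (by linarith))
  linarith [Int.floor_le (y + α), Int.le_ceil (y - α)]

/-- The piecewise linear inequalities between local exponents and the dimension `s`. -/
lemma exponent_bounds {h₁ h₂ τ s t : ℝ} (h2 : 0 < h₂) (h12 : h₂ ≤ h₁) (h21 : h₁ < 2 * h₂)
    (hτ : 0 < τ) (hs1 : s * (τ + h₂) ≤ 2 * h₂ + h₁) (hs2 : s * (τ + h₁) ≤ 3 * h₁)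
    (hs3 : s * τ ≤ h₁ + h₂) (hs4 : s * τ ≤ τ + h₁) (ht : 0 ≤ t) :
    s * t ≤ t + 2 * t ∧ s * t ≤ max h₂ (t - τ) + 2 * t ∧
      s * t ≤ t + max h₁ (max (h₁ + (t - τ)) (2 * (t - τ))) ∧
      s * t ≤ max h₂ (t - τ) + max h₁ (max (h₁ + (t - τ)) (2 * (t - τ))) := by
  have hs : s < 3 := by
    by_contra h
    nlinarith
  have hs5 : s * (τ + h₂) ≤ 2 * τ + 3 * h₂ := by
    rcases le_total (h₁ - h₂) (2 * τ) with h | h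
    · linarith
    · have h3 : 3 * h₁ * (τ + h₂) ≤ (2 * τ + 3 * h₂) * (τ + h₁) := by nlinarith
      have h4 : s * (τ + h₂) * (τ + h₁) ≤ (2 * τ + 3 * h₂) * (τ + h₁) := by nlinarith
      exact le_of_mul_le_mul_right h4 (by linarith)
  set A := max h₂ (t - τ) with hA
  set B := max h₁ (max (h₁ + (t - τ)) (2 * (t - τ))) with hB
  have hA1 : h₂ ≤ A := le_max_left _ _
  have hA2 : t - τ ≤ A := le_max_right _ _
  have hB1 : h₁ ≤ B := le_max_left _ _
  have hB2 : h₁ + (t - τ) ≤ B := (le_max_left _ _).trans (le_max_right _ _)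
  have hB3 : 2 * (t - τ) ≤ B := (le_max_right _ _).trans (le_max_right _ _)
  refine ⟨by nlinarith, ?_, ?_, ?_⟩
  · rcases le_total t (τ + h₂) with h | h
    · rcases le_total s 2 with h' | h'
      · nlinarith
      · nlinarith [mul_le_mul_of_nonneg_left h (sub_nonneg.2 h')]
    · nlinarith [mul_le_mul_of_nonneg_left h (sub_nonneg.2 hs.le)]
  · rcases le_total t τ with h | h
    · rcases le_total s 1 with h' | h'
      · nlinarith
      · nlinarith [mul_le_mul_of_nonneg_left h (sub_nonneg.2 h')]
    · rcases le_total t (τ + h₁) with h3 | h3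
      · rcases le_total s 2 with h' | h'
        · nlinarith [mul_le_mul_of_nonneg_left h (sub_nonneg.2 h')]
        · nlinarith [mul_le_mul_of_nonneg_left h3 (sub_nonneg.2 h')]
      · nlinarith [mul_le_mul_of_nonneg_left h3 (sub_nonneg.2 hs.le)]
  · rcases le_total t τ with h | h
    · rcases le_total s 0 with h' | h'
      · nlinarith
      · nlinarith [mul_le_mul_of_nonneg_left h h']
    · rcases le_total t (τ + h₂) with h3 | h3
      · rcases le_total s 1 with h' | h'
        · nlinarith [mul_le_mul_of_nonneg_left h (sub_nonneg.2 h')]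
        · nlinarith [mul_le_mul_of_nonneg_left h3 (sub_nonneg.2 h')]
      · rcases le_total t (τ + h₁) with h4 | h4
        · rcases le_total s 2 with h' | h'
          · nlinarith [mul_le_mul_of_nonneg_left h3 (sub_nonneg.2 h')]
          · nlinarith [mul_le_mul_of_nonneg_left h4 (sub_nonneg.2 h')]
        · nlinarith [mul_le_mul_of_nonneg_left h4 (sub_nonneg.2 hs.le)]

lemma ball_mass_le_rpow {h₁ h₂ τ s : ℝ} (h2 : 0 < h₂) (h12 : h₂ ≤ h₁) (h21 : h₁ < 2 * h₂)
    (hτ : 0 < τ) (hs1 : s * (τ + h₂) ≤ 2 * h₂ + h₁) (hs2 : s * (τ + h₁) ≤ 3 * h₁)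
    (hs3 : s * τ ≤ h₁ + h₂) (hs4 : s * τ ≤ τ + h₁) {n r : ℝ} (hn : 0 < n) (hr : 0 < r)
    (hr1 : r ≤ 1) :
    (r + min (Real.exp (-(n * h₂))) (r / Real.exp (-(n * τ)))) *
      (r ^ 2 + min (Real.exp (-(n * h₁))) (min (Real.exp (-(n * h₁)) * (r / Real.exp (-(n * τ))))
        ((r / Real.exp (-(n * τ))) ^ 2))) ≤ 4 * r ^ s := by
  set t := -Real.log r / n with ht
  have ht0 : 0 ≤ t := div_nonneg (neg_nonneg.2 (Real.log_nonpos hr.le hr1)) hn.le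
  have hrt : r = Real.exp (-(n * t)) := by
    rw [ht, mul_div_cancel₀ _ hn.ne', neg_neg, Real.exp_log hr]
  have hre : r / Real.exp (-(n * τ)) = Real.exp (-(n * (t - τ))) := by
    rw [hrt, ← Real.exp_sub]; ring_nf
  have hr2 : r ^ 2 = Real.exp (-(n * (2 * t))) := by
    rw [hrt, ← Real.exp_nat_mul]; push_cast; ring_nf
  have hre2 : (r / Real.exp (-(n * τ))) ^ 2 = Real.exp (-(n * (2 * (t - τ)))) := by
    rw [hre, ← Real.exp_nat_mul]; push_cast; ring_nf
  have hanti : Antitone fun x : ℝ => Real.exp (-(n * x)) := fun x y hxy =>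
    Real.exp_le_exp.2 (neg_le_neg (mul_le_mul_of_nonneg_left hxy hn.le))
  have hA : min (Real.exp (-(n * h₂))) (r / Real.exp (-(n * τ))) =
      Real.exp (-(n * max h₂ (t - τ))) := by rw [hre]; exact hanti.map_max.symm
  have hB : min (Real.exp (-(n * h₁))) (min (Real.exp (-(n * h₁)) * (r / Real.exp (-(n * τ))))
        ((r / Real.exp (-(n * τ))) ^ 2)) =
      Real.exp (-(n * max h₁ (max (h₁ + (t - τ)) (2 * (t - τ))))) := by
    rw [hre2, hre, ← Real.exp_add, ← neg_add, ← mul_add]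
    rw [show min (Real.exp (-(n * (h₁ + (t - τ))))) (Real.exp (-(n * (2 * (t - τ))))) =
      Real.exp (-(n * max (h₁ + (t - τ)) (2 * (t - τ)))) from hanti.map_max.symm]
    exact hanti.map_max.symm
  have hrs : r ^ s = Real.exp (-(n * (s * t))) := by
    rw [hrt, ← Real.exp_mul]; ring_nf
  obtain ⟨b1, b2, b3, b4⟩ := exponent_bounds h2 h12 h21 hτ hs1 hs2 hs3 hs4 ht0
  have c := fun {x y z : ℝ} (h : z ≤ x + y) =>
    (show Real.exp (-(n * x)) * Real.exp (-(n * y)) ≤ Real.exp (-(n * z)) by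
      rw [← Real.exp_add, ← neg_add, ← mul_add]; exact hanti h)
  have hr1 : r + Real.exp (-(n * max h₂ (t - τ))) =
      Real.exp (-(n * t)) + Real.exp (-(n * max h₂ (t - τ))) := by rw [← hrt]
  rw [hA, hB, hr2, hrs, hr1]
  rw [add_mul, mul_add, mul_add]
  linarith [c b1, c b2, c b3, c b4]

open scoped ENNReal NNReal in
lemma dimH_le_of_covers {X : Type*} [MetricSpace X] {E : ℕ → Set X}
    {α β C : ℝ} (hβ : 0 < β)
    (h : ∀ᶠ n : ℕ in atTop, ∃ t : Finset X, (t.card : ℝ) ≤ C * Real.exp (n * α) ∧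
      ∀ x ∈ E n, ∃ y ∈ t, dist x y ≤ Real.exp (-(n * β))) :
    dimH {x | ∃ᶠ n in atTop, x ∈ E n} ≤ ENNReal.ofReal (α / β) := by
  borelize X
  refine dimH_le fun d hd => ?_
  rw [← ENNReal.ofReal_coe_nnreal]
  refine ENNReal.ofReal_le_ofReal ?_
  by_contra! hlt
  rw [div_lt_iff₀ hβ] at hlt
  suffices μH[d] {x | ∃ᶠ n in atTop, x ∈ E n} ≤ 0 by
    rw [hd] at this; simp at this
  obtain ⟨n₀, hn₀⟩ := eventually_atTop.1 h
  have hn₁ : ∀ n : ℕ, ∃ t : Finset X, n₀ ≤ n → (t.card : ℝ) ≤ C * Real.exp (n * α) ∧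
      ∀ x ∈ E n, ∃ y ∈ t, dist x y ≤ Real.exp (-(n * β)) := fun n => by
    by_cases hn : n₀ ≤ n
    · exact (hn₀ n hn).imp fun t ht _ => ht
    · exact ⟨∅, fun h => absurd h hn⟩
  choose t ht using hn₁
  set q := Real.exp (α - d * β) with hq
  have hq1 : q < 1 := by rw [hq, Real.exp_lt_one_iff]; linarith
  have hq0 : 0 < q := Real.exp_pos _
  set f : ℕ → ℝ≥0∞ := fun n => ENNReal.ofReal (C * 2 ^ (d : ℝ) * q ^ n) with hf
  have hsum : ∑' n, f n ≠ ∞ := by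
    have : Summable fun n => C * 2 ^ (d : ℝ) * q ^ n :=
      (summable_geometric_of_lt_one hq0.le hq1).mul_left _
    exact this.tsum_ofReal_ne_top
  have htail := ENNReal.tendsto_sum_nat_add f hsum
  have hsize : Tendsto (fun N : ℕ => ENNReal.ofReal (2 * Real.exp (-(N * β)))) atTop (𝓝 0) := by
    rw [← ENNReal.ofReal_zero]
    refine ENNReal.tendsto_ofReal ?_
    rw [← mul_zero (2 : ℝ)]
    refine (Real.tendsto_exp_atBot.comp ?_).const_mul 2
    exact tendsto_neg_atTop_atBot.comp (tendsto_natCast_atTop_atTop.atTop_mul_const hβ)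
  have hdiam : ∀ (n : ℕ) (y : X), ediam (closedBall y (Real.exp (-(n * β)))) ≤
      ENNReal.ofReal (2 * Real.exp (-(n * β))) := fun n y => by
    refine ediam_le fun a ha b hb => ?_
    rw [edist_dist]
    refine ENNReal.ofReal_le_ofReal ?_
    linarith [dist_triangle_right a b y, mem_closedBall.1 ha, mem_closedBall.1 hb]
  have hle := Measure.hausdorffMeasure_le_liminf_tsum (X := X) d
    {x | ∃ᶠ n in atTop, x ∈ E n} (l := atTop)
    (ι := fun N : ℕ => Σ n : ℕ, {y // y ∈ t (n + N)})
    (fun N => ENNReal.ofReal (2 * Real.exp (-(N * β)))) hsize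
    (fun N i => closedBall (i.2 : X) (Real.exp (-((i.1 + N : ℕ) * β))))
    (Eventually.of_forall fun N i => (hdiam _ _).trans (ENNReal.ofReal_le_ofReal ?_)) ?_
  · refine hle.trans (le_trans (liminf_le_liminf (v := fun N => ∑' n, f (n + N)) ?_) ?_)
    · refine (eventually_ge_atTop n₀).mono fun N hN => ?_
      rw [ENNReal.tsum_sigma']
      refine ENNReal.tsum_le_tsum fun n => ?_
      rw [tsum_fintype]
      refine (Finset.sum_le_card_nsmul _ _ (ENNReal.ofReal (2 * Real.exp (-((n + N : ℕ) * β))) ^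
        (d : ℝ)) fun i _ => ENNReal.rpow_le_rpow (hdiam _ _) d.2).trans ?_
      rw [nsmul_eq_mul, ENNReal.ofReal_rpow_of_pos (by positivity), ← ENNReal.ofReal_natCast,
        ← ENNReal.ofReal_mul (by positivity)]
      refine ENNReal.ofReal_le_ofReal ?_
      have h1 := (ht (n + N) (by omega)).1
      rw [Finset.card_univ, Fintype.card_coe, Real.mul_rpow (by norm_num) (Real.exp_pos _).le]
      have h2 : q ^ (n + N) = Real.exp ((n + N : ℕ) * α) *
          Real.exp (-((n + N : ℕ) * β)) ^ (d : ℝ) := by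
        rw [hq, ← Real.exp_nat_mul, ← Real.exp_mul, ← Real.exp_add]; ring_nf
      rw [h2]
      calc _ ≤ C * Real.exp ((n + N : ℕ) * α) * (2 ^ (d : ℝ) *
            Real.exp (-((n + N : ℕ) * β)) ^ (d : ℝ)) :=
            mul_le_mul_of_nonneg_right h1 (by positivity)
        _ = _ := by ring
    · exact htail.liminf_eq.le
  · push_cast
    gcongr
    nlinarith [(Nat.cast_nonneg i.1 : (0 : ℝ) ≤ i.1)]
  · refine (eventually_ge_atTop n₀).mono fun N hN x hx => ?_
    obtain ⟨n, hn, hxn⟩ := frequently_atTop.1 hx N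
    obtain ⟨y, hy, hxy⟩ := (ht n (hN.trans hn)).2 x hxn
    obtain ⟨k, rfl⟩ := Nat.exists_eq_add_of_le' hn
    exact Set.mem_iUnion.2 ⟨⟨k, ⟨y, hy⟩⟩, hxy⟩

lemma exists_cover_interval {w r : ℝ} (hw : 0 ≤ w) (hr : 0 < r) :
    ∃ t : Finset ℝ, (t.card : ℝ) ≤ w / r + 1 ∧ ∀ x, |x| ≤ w → ∃ y ∈ t, |x - y| ≤ r := by
  refine ⟨(Finset.range (⌊w / r⌋₊ + 1)).image fun j : ℕ => -w + r + 2 * r * (j : ℝ), ?_, ?_⟩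
  · refine (Nat.cast_le.2 Finset.card_image_le).trans ?_
    rw [Finset.card_range]
    push_cast
    linarith [Nat.floor_le (div_nonneg hw hr.le)]
  · intro x hx
    have hx := abs_le.1 hx
    have h0 : 0 ≤ (x + w) / (2 * r) := div_nonneg (by linarith) (by linarith)
    have h1 := Nat.floor_le h0
    have h2 := Nat.lt_floor_add_one ((x + w) / (2 * r))
    rw [le_div_iff₀ (by linarith)] at h1
    rw [div_lt_iff₀ (by linarith)] at h2
    refine ⟨_, Finset.mem_image_of_mem _ (a := ⌊(x + w) / (2 * r)⌋₊) ?_, ?_⟩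
    · rw [Finset.mem_range, Nat.lt_succ_iff]
      refine Nat.floor_le_floor ?_
      rw [div_le_div_iff₀ (by linarith) hr]
      nlinarith
    · rw [abs_le]; constructor <;> linarith

lemma exists_cover_boxes {ι : Type*} (W : Finset ι) (p : ι → ℝ × ℝ × ℝ) {w₁ w₂ w₃ r : ℝ}
    (hw₁ : 0 ≤ w₁) (hw₂ : 0 ≤ w₂) (hw₃ : 0 ≤ w₃) (hr : 0 < r) :
    ∃ t : Finset (ℝ × ℝ × ℝ),
      (t.card : ℝ) ≤ W.card * ((w₁ / r + 1) * ((w₂ / r + 1) * (w₃ / r + 1))) ∧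
      ∀ x : ℝ × ℝ × ℝ, (∃ i ∈ W, |x.1 - (p i).1| ≤ w₁ ∧ |x.2.1 - (p i).2.1| ≤ w₂ ∧
        |x.2.2 - (p i).2.2| ≤ w₃) → ∃ y ∈ t, dist x y ≤ r := by
  classical
  obtain ⟨t₁, ht₁, h₁⟩ := exists_cover_interval hw₁ hr
  obtain ⟨t₂, ht₂, h₂⟩ := exists_cover_interval hw₂ hr
  obtain ⟨t₃, ht₃, h₃⟩ := exists_cover_interval hw₃ hr
  refine ⟨(W ×ˢ t₁ ×ˢ t₂ ×ˢ t₃).image fun q => p q.1 + q.2, ?_, ?_⟩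
  · refine (Nat.cast_le.2 Finset.card_image_le).trans ?_
    simp only [Finset.card_product]
    push_cast
    gcongr
  · rintro x ⟨i, hi, hx₁, hx₂, hx₃⟩
    obtain ⟨y₁, hy₁, hd₁⟩ := h₁ _ hx₁
    obtain ⟨y₂, hy₂, hd₂⟩ := h₂ _ hx₂
    obtain ⟨y₃, hy₃, hd₃⟩ := h₃ _ hx₃
    refine ⟨_, Finset.mem_image_of_mem _ (a := (i, y₁, y₂, y₃)) (by simp [*]), ?_⟩
    simp only [Prod.dist_eq, Real.dist_eq, Prod.fst_add, Prod.snd_add, max_le_iff, ← sub_sub]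
    exact ⟨hd₁, hd₂, hd₃⟩

lemma dimH_le_of_boxes {ι : Type*} {E : ℕ → Set (ℝ × ℝ × ℝ)} {W : ℕ → Finset ι}
    {p : ℕ → ι → ℝ × ℝ × ℝ} {κ ω₁ ω₂ ω₃ γ₁ γ₂ γ₃ β C : ℝ} (hγ₁ : 0 ≤ γ₁)
    (hγ₂ : 0 ≤ γ₂) (hγ₃ : 0 ≤ γ₃) (hβ : 0 < β) (hC : 0 < C) (h₁ : β - ω₁ ≤ γ₁)
    (h₂ : β - ω₂ ≤ γ₂) (h₃ : β - ω₃ ≤ γ₃)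
    (hW : ∀ᶠ n : ℕ in atTop, ((W n).card : ℝ) ≤ C * Real.exp (n * κ) ∧
      ∀ x ∈ E n, ∃ i ∈ W n, |x.1 - (p n i).1| ≤ C * Real.exp (-(n * ω₁)) ∧
        |x.2.1 - (p n i).2.1| ≤ C * Real.exp (-(n * ω₂)) ∧
        |x.2.2 - (p n i).2.2| ≤ C * Real.exp (-(n * ω₃))) :
    dimH {x | ∃ᶠ n in atTop, x ∈ E n} ≤ ENNReal.ofReal ((κ + γ₁ + γ₂ + γ₃) / β) := by
  refine dimH_le_of_covers (C := C * (C + 1) ^ 3) hβ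
    (hW.mono fun n ⟨hWn, hE⟩ => ?_)
  obtain ⟨t, ht, hcov⟩ := exists_cover_boxes (W n) (p n)
    (w₁ := C * Real.exp (-(n * ω₁))) (w₂ := C * Real.exp (-(n * ω₂)))
    (w₃ := C * Real.exp (-(n * ω₃))) (by positivity) (by positivity) (by positivity)
    (Real.exp_pos (-(n * β)))
  refine ⟨t, ht.trans ?_, fun x hx => hcov x (hE x hx)⟩
  have key : ∀ {ω γ : ℝ}, 0 ≤ γ → β - ω ≤ γ →
      C * Real.exp (-(n * ω)) / Real.exp (-(n * β)) + 1 ≤ (C + 1) * Real.exp (n * γ) := by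
    intro ω γ h0 h
    have e1 : Real.exp (-(n * ω)) / Real.exp (-(n * β)) ≤ Real.exp (n * γ) := by
      rw [← Real.exp_sub]
      refine Real.exp_le_exp.2 ?_
      nlinarith [(Nat.cast_nonneg n : (0 : ℝ) ≤ n)]
    have e2 : 1 ≤ Real.exp (n * γ) := Real.one_le_exp (by positivity)
    rw [mul_div_assoc]
    nlinarith
  calc _ ≤ C * Real.exp (n * κ) * ((C + 1) * Real.exp (n * γ₁) * ((C + 1) * Real.exp (n * γ₂) *
        ((C + 1) * Real.exp (n * γ₃)))) := by
        gcongr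
        exacts [key hγ₁ h₁, key hγ₂ h₂, key hγ₃ h₃]
    _ = _ := by
        simp only [mul_add, Real.exp_add]; ring

/-- The recurrence set in coordinates in which the matrix is `diag(m, l, 1 / l)`. The second and
third coordinates of the integer vectors are given by `U` and `-S`. -/
def eigenRecSet (m l : ℝ) (U S : ℤ × ℤ → ℝ) (τ C : ℝ) : Set (ℝ × ℝ × ℝ) :=
  {x | ∃ᶠ n : ℕ in atTop, ∃ k : ℤ, ∃ v : ℤ × ℤ,
    |(m ^ n - 1) * x.1 - k| < C * Real.exp (-(n * τ)) ∧
    |(l ^ n - 1) * x.2.1 - U v| < C * Real.exp (-(n * τ)) ∧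
    |(1 - l⁻¹ ^ n) * x.2.2 - S v| < C * Real.exp (-(n * τ))}

lemma exists_finset_of_forms {U S : ℤ × ℤ → ℝ} (hU : ∀ v w, U (v - w) = U v - U w)
    (hS : ∀ v w, S (v - w) = S v - S w) (hUS : ∀ v, v ≠ 0 → 1 ≤ |U v * S v|)
    {u₀ s₀ α β : ℝ} (hα : 0 ≤ α) (hβ : 0 ≤ β) :
    ∃ W : Finset (ℤ × ℤ), (W.card : ℝ) ≤ 4 * (α * β) + 1 ∧
      ∀ v, v ∈ W ↔ |U v - u₀| ≤ α ∧ |S v - s₀| ≤ β := by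
  have hfin : {v | |U v - u₀| ≤ α ∧ |S v - s₀| ≤ β}.Finite := by
    by_contra h
    obtain ⟨t, ht, hc⟩ := Set.Infinite.exists_subset_card_eq h (⌊4 * (α * β) + 1⌋₊ + 1)
    have h1 := card_le_of_forms hU hS hUS hα hβ (fun v hv => (ht hv).1) (fun v hv => (ht hv).2)
    rw [hc] at h1
    push_cast at h1
    linarith [Nat.lt_floor_add_one (4 * (α * β) + 1)]
  refine ⟨hfin.toFinset, card_le_of_forms hU hS hUS hα hβ (u₀ := u₀) (s₀ := s₀) ?_ ?_,
    fun v => by simp⟩ <;> intro v hv <;> simp at hv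
  exacts [hv.1, hv.2]

lemma half_pow_le_sub_one {m : ℝ} (hm : 2 ≤ m) {n : ℕ} (hn : n ≠ 0) :
    m ^ n / 2 ≤ m ^ n - 1 := by
  have : m ≤ m ^ n := le_self_pow₀ (by linarith) hn
  linarith

lemma half_le_one_sub_inv_pow {m : ℝ} (hm : 2 ≤ m) {n : ℕ} (hn : n ≠ 0) :
    1 / 2 ≤ 1 - m⁻¹ ^ n := by
  have h1 : m⁻¹ ^ n ≤ m⁻¹ :=
    pow_le_of_le_one (inv_nonneg.2 (by linarith)) (inv_le_one_of_one_le₀ (by linarith)) hn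
  have h2 : m⁻¹ ≤ 2⁻¹ := inv_anti₀ (by norm_num) hm
  linarith

lemma exp_mul_log {m : ℝ} (hm : 0 < m) (n : ℕ) : Real.exp (n * Real.log m) = m ^ n := by
  rw [mul_comm, Real.exp_mul, Real.exp_log hm, Real.rpow_natCast]

/-- Each box of `eigenRecSet` has its centre close to the given point. -/
lemma abs_sub_div_le {M x k e c : ℝ} (hc : 0 < c) (hM : c ≤ M) (h : |M * x - k| ≤ e) :
    |x - k / M| ≤ e / c := by
  have hM0 : 0 < M := hc.trans_le hM
  have : x - k / M = (M * x - k) / M := by field_simp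
  rw [this, abs_div, abs_of_pos hM0]
  have he : 0 ≤ e := (abs_nonneg _).trans h
  exact div_le_div₀ he h hc hM

section

variable {m l : ℝ} {U S : ℤ × ℤ → ℝ} {τ C : ℝ}

lemma eigenRecSet_subset_iUnion :
    eigenRecSet m l U S τ C ⊆ ⋃ R : ℕ, {x | ∃ᶠ n : ℕ in atTop, x ∈
      {x : ℝ × ℝ × ℝ | |x.1| ≤ R ∧ |x.2.1| ≤ R ∧ |x.2.2| ≤ R ∧ ∃ k : ℤ, ∃ v : ℤ × ℤ,
        |(m ^ n - 1) * x.1 - k| < C * Real.exp (-(n * τ)) ∧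
        |(l ^ n - 1) * x.2.1 - U v| < C * Real.exp (-(n * τ)) ∧
        |(1 - l⁻¹ ^ n) * x.2.2 - S v| < C * Real.exp (-(n * τ))}} := by
  intro x hx
  obtain ⟨R, hR⟩ := exists_nat_ge (max |x.1| (max |x.2.1| |x.2.2|))
  simp only [max_le_iff] at hR
  exact Set.mem_iUnion.2 ⟨R, hx.mono fun n h => ⟨hR.1, hR.2.1, hR.2.2, h⟩⟩

lemma eigenRecSet_box_counts (hU : ∀ v w, U (v - w) = U v - U w)
    (hS : ∀ v w, S (v - w) = S v - S w) (hUS : ∀ v, v ≠ 0 → 1 ≤ |U v * S v|) (hm : 2 ≤ m)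
    (hl : 2 ≤ l) (hτ : 0 < τ) (hC : 0 < C) (R : ℕ) {n : ℕ} (hn : n ≠ 0) :
    ∃ (K : Finset ℤ) (V : Finset (ℤ × ℤ)),
      (K.card : ℝ) ≤ 3 * (R + C + 1) * m ^ n ∧ (V.card : ℝ) ≤ 5 * (R + C + 1) ^ 2 * l ^ n ∧
      ∀ x : ℝ × ℝ × ℝ, (|x.1| ≤ R ∧ |x.2.1| ≤ R ∧ |x.2.2| ≤ R ∧ ∃ k : ℤ, ∃ v : ℤ × ℤ,
        |(m ^ n - 1) * x.1 - k| < C * Real.exp (-(n * τ)) ∧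
        |(l ^ n - 1) * x.2.1 - U v| < C * Real.exp (-(n * τ)) ∧
        |(1 - l⁻¹ ^ n) * x.2.2 - S v| < C * Real.exp (-(n * τ))) →
      ∃ k ∈ K, ∃ v ∈ V,
        |x.1 - k / (m ^ n - 1)| ≤ 2 * C * Real.exp (-(n * (τ + Real.log m))) ∧
        |x.2.1 - U v / (l ^ n - 1)| ≤ 2 * C * Real.exp (-(n * (τ + Real.log l))) ∧
        |x.2.2 - S v / (1 - l⁻¹ ^ n)| ≤ 2 * C * Real.exp (-(n * τ)) := by
  set D : ℝ := R + C + 1 with hD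
  have hR0 : (0 : ℝ) ≤ R := R.cast_nonneg
  have hm1 : 1 ≤ m ^ n := one_le_pow₀ (by linarith)
  have hl1 : 1 ≤ l ^ n := one_le_pow₀ (by linarith)
  have hl2 : 0 < l⁻¹ ^ n := pow_pos (inv_pos.2 (by linarith)) n
  have hm2 := half_pow_le_sub_one hm hn
  have hl3 := half_pow_le_sub_one hl hn
  have hl4 := half_le_one_sub_inv_pow hl hn
  have he : Real.exp (-(n * τ)) ≤ 1 := Real.exp_le_one_iff.2 (by simp; positivity)
  have hCe : C * Real.exp (-(n * τ)) ≤ C := by nlinarith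
  obtain ⟨V, hV, hVm⟩ := exists_finset_of_forms hU hS hUS (u₀ := 0) (s₀ := 0)
    (α := D * l ^ n) (β := D) (by positivity) (by positivity)
  have hwid : ∀ {M x k y : ℝ}, y * (1 / 2) ≤ M → 1 ≤ y → |M * x - k| < C * Real.exp (-(n * τ)) →
      |x - k / M| ≤ 2 * C * (Real.exp (-(n * τ)) / y) := fun {M x k y} h h1 h2 =>
    (abs_sub_div_le (by positivity) h h2.le).trans_eq (by field_simp)
  have hbd : ∀ {M x k y : ℝ}, 0 ≤ M → M ≤ y → 1 ≤ y → |x| ≤ R →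
      |M * x - k| < C * Real.exp (-(n * τ)) → |k - 0| ≤ D * y := fun {M x k y} h0 h h1 hx h2 => by
    have h3 : |M * x| ≤ y * R := by
      rw [abs_mul, abs_of_nonneg h0]
      exact mul_le_mul h hx (abs_nonneg _) (h0.trans h)
    have h4 := abs_le.1 h3
    have h5 := abs_lt.1 h2
    rw [sub_zero, abs_le, hD]
    constructor <;> nlinarith
  have hexp : ∀ {y : ℝ}, 0 < y → Real.exp (-(n * (τ + Real.log y))) =
      Real.exp (-(n * τ)) / y ^ n := fun {y} hy => by
    rw [← exp_mul_log hy, ← Real.exp_sub]; ring_nf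
  have hfl : 0 ≤ ⌊D * m ^ n⌋ := Int.floor_nonneg.2 (by positivity)
  refine ⟨Finset.Icc (-⌊D * m ^ n⌋) ⌊D * m ^ n⌋, V, ?_, hV.trans ?_, ?_⟩
  · rw [Int.card_Icc]
    have h1 : ((⌊D * m ^ n⌋ + 1 - -⌊D * m ^ n⌋).toNat : ℝ) =
        ((⌊D * m ^ n⌋ + 1 - -⌊D * m ^ n⌋ : ℤ) : ℝ) := by
      exact_mod_cast Int.toNat_of_nonneg (by omega)
    rw [h1]
    push_cast
    nlinarith [Int.floor_le (D * m ^ n)]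
  · nlinarith [mul_le_mul (show 1 ≤ D ^ 2 by nlinarith) hl1 zero_le_one (sq_nonneg D)]
  · rintro x ⟨hx1, hx2, hx3, k, v, h1, h2, h3⟩
    have b1 := hbd (by linarith) (by linarith : m ^ n - 1 ≤ m ^ n) hm1 hx1 h1
    have b2 := hbd (by linarith) (by linarith : l ^ n - 1 ≤ l ^ n) hl1 hx2 h2
    have b3 := hbd (by linarith) (by linarith : 1 - l⁻¹ ^ n ≤ 1) le_rfl hx3 h3
    rw [mul_one] at b3
    rw [sub_zero] at b1
    refine ⟨k, Finset.mem_Icc.2 ?_, v, (hVm v).2 ⟨b2, b3⟩, ?_, ?_, ?_⟩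
    · have := abs_le.1 b1
      exact ⟨neg_le.2 (Int.le_floor.2 (by push_cast; linarith)), Int.le_floor.2 this.2⟩
    · rw [hexp (by linarith)]; exact hwid (by linarith) hm1 h1
    · rw [hexp (by linarith)]; exact hwid (by linarith) hl1 h2
    · simpa using hwid (y := 1) (by linarith) le_rfl h3

theorem dimH_eigenRecSet_le (hU : ∀ v w, U (v - w) = U v - U w)
    (hS : ∀ v w, S (v - w) = S v - S w) (hUS : ∀ v, v ≠ 0 → 1 ≤ |U v * S v|) (hm : 2 ≤ m)
    (hml : m ≤ l) (hτ : 0 < τ) (hC : 0 < C) :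
    dimH (eigenRecSet m l U S τ C)
      ≤ ENNReal.ofReal (min ((2 * Real.log m + Real.log l) / (τ + Real.log m))
          (min (3 * Real.log l / (τ + Real.log l))
            (min ((Real.log l + Real.log m) / τ)
              ((τ + Real.log l) / τ)))) := by
  have hl : 2 ≤ l := hm.trans hml
  have h2 : 0 < Real.log m := Real.log_pos (by linarith)
  have h12 : Real.log m ≤ Real.log l := Real.log_le_log (by linarith) hml
  refine (dimH_mono eigenRecSet_subset_iUnion).trans ?_
  rw [dimH_iUnion]
  refine iSup_le fun R => ?_
  have hcounts := fun n : ℕ => @eigenRecSet_box_counts m l U S τ C hU hS hUS hm hl hτ hC R n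
  choose! K V hK hV hcov using hcounts
  set D : ℝ := R + C + 1 with hD
  have hR0 : (0 : ℝ) ≤ R := R.cast_nonneg
  have hD1 : 1 ≤ D := by linarith
  have hCD : 2 * C ≤ 15 * D ^ 3 := by nlinarith [one_le_pow₀ hD1 (n := 2)]
  have key : ∀ {γ₁ γ₂ γ₃ β : ℝ}, 0 ≤ γ₁ → 0 ≤ γ₂ → 0 ≤ γ₃ → 0 < β →
      β - (τ + Real.log m) ≤ γ₁ → β - (τ + Real.log l) ≤ γ₂ → β - τ ≤ γ₃ → _ :=
    fun {γ₁ γ₂ γ₃ β} i1 i2 i3 hβ j1 j2 j3 =>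
    dimH_le_of_boxes (E := fun n : ℕ => {x : ℝ × ℝ × ℝ | |x.1| ≤ R ∧ |x.2.1| ≤ R ∧ |x.2.2| ≤ R ∧
        ∃ k : ℤ, ∃ v : ℤ × ℤ,
        |(m ^ n - 1) * x.1 - k| < C * Real.exp (-(n * τ)) ∧
        |(l ^ n - 1) * x.2.1 - U v| < C * Real.exp (-(n * τ)) ∧
        |(1 - l⁻¹ ^ n) * x.2.2 - S v| < C * Real.exp (-(n * τ))})
      (W := fun n => K n ×ˢ V n)
      (p := fun n i => (i.1 / (m ^ n - 1), U i.2 / (l ^ n - 1), S i.2 / (1 - l⁻¹ ^ n)))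
      (κ := Real.log m + Real.log l) (C := 15 * D ^ 3) i1 i2 i3 hβ (by positivity) j1 j2 j3
      ((eventually_ne_atTop 0).mono fun n hn => by
        refine ⟨?_, fun x hx => ?_⟩
        · rw [Finset.card_product, mul_add, Real.exp_add, exp_mul_log (by linarith),
            exp_mul_log (by linarith)]
          push_cast
          calc _ ≤ 3 * D * m ^ n * (5 * D ^ 2 * l ^ n) :=
                mul_le_mul (hK n hn) (hV n hn) (Nat.cast_nonneg _) (by positivity)
            _ = _ := by ring
        · obtain ⟨k, hk, v, hv, a1, a2, a3⟩ := hcov n hn x hx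
          refine ⟨(k, v), Finset.mk_mem_product hk hv, a1.trans ?_, a2.trans ?_, a3.trans ?_⟩ <;>
            gcongr)
  refine le_of_le_of_eq (le_min (key (γ₁ := 0) (γ₂ := 0) (γ₃ := Real.log m) (β := τ + Real.log m)
    le_rfl le_rfl h2.le (by linarith) (by linarith) (by linarith) (by linarith)) (le_min
    (key (γ₁ := Real.log l - Real.log m) (γ₂ := 0) (γ₃ := Real.log l) (β := τ + Real.log l)
    (by linarith) le_rfl (by linarith) (by linarith) (by linarith) (by linarith) (by linarith))
    (le_min (key (γ₁ := 0) (γ₂ := 0) (γ₃ := 0) (β := τ)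
    le_rfl le_rfl le_rfl hτ (by linarith) (by linarith) (by linarith))
    (dimH_le_of_boxes (W := V) (κ := Real.log l) (ω₁ := 0) (ω₂ := τ + Real.log l) (ω₃ := τ)
      (p := fun n i => (0, U i / (l ^ n - 1), S i / (1 - l⁻¹ ^ n))) (C := 15 * D ^ 3) (γ₁ := τ)
      (γ₂ := 0) (γ₃ := 0) (β := τ) hτ.le le_rfl le_rfl hτ (by positivity) (by linarith)
      (by linarith) (by linarith)
      ((eventually_ne_atTop 0).mono fun n hn => ⟨?_, fun x hx => ?_⟩))))) ?_
  · rw [exp_mul_log (by linarith)]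
    refine (hV n hn).trans (mul_le_mul_of_nonneg_right ?_ (by positivity))
    nlinarith [one_le_pow₀ hD1 (n := 2)]
  · obtain ⟨k, hk, v, hv, a1, a2, a3⟩ := hcov n hn x hx
    refine ⟨v, hv, ?_, a2.trans ?_, a3.trans ?_⟩
    · have := hx.1
      simp only [sub_zero, mul_zero, neg_zero, Real.exp_zero, mul_one]
      nlinarith [one_le_pow₀ hD1 (n := 2)]
    all_goals gcongr
  · have hmono : Monotone ENNReal.ofReal := fun _ _ h => ENNReal.ofReal_le_ofReal h
    simp only [← hmono.map_min]
    refine congrArg _ (congrArg₂ _ ?_ (congrArg₂ _ ?_ (congrArg₂ _ ?_ ?_))) <;> ring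
end

/-- A bump of integral `1` supported on the box of half side lengths `w` centred at `p`. -/
noncomputable def boxBump (w p x : ℝ × ℝ × ℝ) : ℝ :=
  tent w.1 p.1 x.1 * (tent w.2.1 p.2.1 x.2.1 * tent w.2.2 p.2.2 x.2.2)

lemma continuous_boxBump (w p : ℝ × ℝ × ℝ) : Continuous (boxBump w p) := by
  have := continuous_tent w.1 p.1
  have := continuous_tent w.2.1 p.2.1
  have := continuous_tent w.2.2 p.2.2
  unfold boxBump
  fun_prop

section boxBump

variable {w : ℝ × ℝ × ℝ}

lemma boxBump_nonneg (h₁ : 0 < w.1) (h₂ : 0 < w.2.1) (h₃ : 0 < w.2.2)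
    (p : ℝ × ℝ × ℝ) (x : ℝ × ℝ × ℝ) : 0 ≤ boxBump w p x :=
  mul_nonneg (tent_nonneg h₁ _ _) (mul_nonneg (tent_nonneg h₂ _ _) (tent_nonneg h₃ _ _))

lemma boxBump_eq_zero (h₁ : 0 < w.1) (h₂ : 0 < w.2.1) (h₃ : 0 < w.2.2)
    (p : ℝ × ℝ × ℝ) {x : ℝ × ℝ × ℝ}
    (hx : ¬ (|x.1 - p.1| ≤ w.1 ∧ |x.2.1 - p.2.1| ≤ w.2.1 ∧ |x.2.2 - p.2.2| ≤ w.2.2)) :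
    boxBump w p x = 0 := by
  unfold boxBump
  by_cases a : |x.1 - p.1| ≤ w.1
  · by_cases b : |x.2.1 - p.2.1| ≤ w.2.1
    · rw [tent_eq_zero h₃ p.2.2 (not_le.1 fun h => hx ⟨a, b, h⟩), mul_zero, mul_zero]
    · rw [tent_eq_zero h₂ p.2.1 (not_le.1 b), zero_mul, mul_zero]
  · rw [tent_eq_zero h₁ p.1 (not_le.1 a), zero_mul]

lemma integral_boxBump (h₁ : 0 < w.1) (h₂ : 0 < w.2.1) (h₃ : 0 < w.2.2)
    (p : ℝ × ℝ × ℝ) : ∫ x, boxBump w p x = 1 := by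
  unfold boxBump
  rw [Measure.volume_eq_prod, integral_prod_mul (tent w.1 p.1)
    (fun q : ℝ × ℝ => tent w.2.1 p.2.1 q.1 * tent w.2.2 p.2.2 q.2), Measure.volume_eq_prod,
    integral_prod_mul, integral_tent h₁, integral_tent h₂, integral_tent h₃]
  norm_num

end boxBump

lemma setIntegral_boxBump (w p x : ℝ × ℝ × ℝ) (r : ℝ) :
    ∫ y in closedBall x r, boxBump w p y = (∫ y in closedBall x.1 r, tent w.1 p.1 y) *
      ((∫ y in closedBall x.2.1 r, tent w.2.1 p.2.1 y) *
        ∫ y in closedBall x.2.2 r, tent w.2.2 p.2.2 y) := by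
  obtain ⟨x₁, x₂, x₃⟩ := x
  unfold boxBump
  rw [← closedBall_prod_same, ← closedBall_prod_same, Measure.volume_eq_prod,
    setIntegral_prod_mul (tent w.1 p.1)
    (fun q : ℝ × ℝ => tent w.2.1 p.2.1 q.1 * tent w.2.2 p.2.2 q.2), Measure.volume_eq_prod,
    setIntegral_prod_mul]

lemma setIntegral_tent_le_min {w : ℝ} (hw : 0 < w) (p : ℝ) {x r : ℝ} (hr : 0 < r) :
    ∫ y in closedBall x r, tent w p y ≤ min 1 (2 * r / w) :=
  le_min (setIntegral_tent_le_one hw p x r) (setIntegral_tent_le hw p hr)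

/-- The mass which a family of bumps gives to a ball, in terms of the number of bumps near it. -/
lemma setIntegral_sum_boxBump_le {ι : Type*} [DecidableEq ι] {w : ℝ × ℝ × ℝ} (h₁ : 0 < w.1)
    (h₂ : 0 < w.2.1) (h₃ : 0 < w.2.2) (W : Finset ι) (p : ι → ℝ × ℝ × ℝ) {H r N : ℝ} (hH : 0 ≤ H)
    (hr : 0 < r) (x : ℝ × ℝ × ℝ)
    (hN : ∀ V ⊆ W, (∀ i ∈ V, |x.1 - (p i).1| ≤ r + w.1 ∧ |x.2.1 - (p i).2.1| ≤ r + w.2.1 ∧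
      |x.2.2 - (p i).2.2| ≤ r + w.2.2) → (V.card : ℝ) ≤ N) :
    ∫ y in closedBall x r, ∑ i ∈ W, H * boxBump w (p i) y ≤
      H * (min 1 (2 * r / w.1) * (min 1 (2 * r / w.2.1) * min 1 (2 * r / w.2.2))) * N := by
  classical
  rw [integral_finsetSum]
  swap
  · exact fun i _ => ((continuous_boxBump w (p i)).const_mul H).continuousOn.integrableOn_compact
      (isCompact_closedBall _ _)
  set V := W.filter fun i => |x.1 - (p i).1| ≤ r + w.1 ∧ |x.2.1 - (p i).2.1| ≤ r + w.2.1 ∧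
      |x.2.2 - (p i).2.2| ≤ r + w.2.2 with hV
  have hi : ∀ i, ∫ y in closedBall x r, H * boxBump w (p i) y ≤
      H * (min 1 (2 * r / w.1) * (min 1 (2 * r / w.2.1) * min 1 (2 * r / w.2.2))) := fun i => by
    rw [integral_const_mul, setIntegral_boxBump]
    refine mul_le_mul_of_nonneg_left ?_ hH
    refine mul_le_mul (setIntegral_tent_le_min h₁ _ hr) (mul_le_mul
      (setIntegral_tent_le_min h₂ _ hr) (setIntegral_tent_le_min h₃ _ hr)
      (setIntegral_tent_nonneg h₃ _ _ _) (by positivity)) (mul_nonneg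
      (setIntegral_tent_nonneg h₂ _ _ _) (setIntegral_tent_nonneg h₃ _ _ _)) (by positivity)
  have hi0 : ∀ i ∈ W, i ∉ V → ∫ y in closedBall x r, H * boxBump w (p i) y = 0 := by
    intro i hiW hiV
    rw [integral_const_mul, setIntegral_boxBump]
    by_cases a : |x.1 - (p i).1| ≤ r + w.1
    · by_cases b : |x.2.1 - (p i).2.1| ≤ r + w.2.1
      · rw [setIntegral_tent_eq_zero h₃ (p i).2.2 (not_le.1 fun h =>
          hiV (Finset.mem_filter.2 ⟨hiW, a, b, h⟩)), mul_zero, mul_zero, mul_zero]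
      · rw [setIntegral_tent_eq_zero h₂ (p i).2.1 (not_le.1 b), zero_mul, mul_zero, mul_zero]
    · rw [setIntegral_tent_eq_zero h₁ (p i).1 (not_le.1 a), zero_mul, mul_zero]
  rw [← Finset.sum_subset (Finset.filter_subset _ W) hi0]
  refine (Finset.sum_le_card_nsmul _ _ _ fun i _ => hi i).trans ?_
  rw [nsmul_eq_mul, mul_comm]
  exact mul_le_mul_of_nonneg_left (hN V (Finset.filter_subset _ _) fun i hi =>
    (Finset.mem_filter.1 hi).2) (by positivity)

/-- Finitely many cells of a partition into cells of equal volume cover a ball. -/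
lemma exists_finset_cells {X ι : Type*} [MetricSpace X] [ProperSpace X] [MeasurableSpace X]
    [BorelSpace X] {ν : Measure X} [IsFiniteMeasureOnCompacts ν] (q : X → ι) {p : ι → X}
    {δ : ℝ} (hqm : ∀ i, MeasurableSet (q ⁻¹' {i})) (hqp : ∀ i, q ⁻¹' {i} ⊆ closedBall (p i) δ)
    {H : ENNReal} (hH : 0 < H) (hq : ∀ i, ν (q ⁻¹' {i}) = H) (x₀ : X) (R : ℝ) :
    ∃ W : Finset ι, closedBall x₀ R ⊆ ⋃ i ∈ W, q ⁻¹' {i} ∧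
      ∑ i ∈ W, ν.real (q ⁻¹' {i}) ≤ ν.real (closedBall x₀ (R + 2 * δ)) := by
  have hdisj : Pairwise (Function.onFun Disjoint fun i : ι => q ⁻¹' {i}) := fun i j hij =>
    Disjoint.preimage q (Set.disjoint_singleton.2 hij)
  have hsub : ∀ i ∈ q '' closedBall x₀ R, q ⁻¹' {i} ⊆ closedBall x₀ (R + 2 * δ) := by
    rintro _ ⟨x, hx, rfl⟩ y hy
    have h1 := mem_closedBall.1 (hqp (q x) hy)
    have h2 := mem_closedBall.1 (hqp (q x) (Set.mem_preimage.2 rfl : x ∈ _))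
    have h3 := mem_closedBall.1 hx
    rw [mem_closedBall]
    linarith [dist_triangle_right y x (p (q x)), dist_triangle y x x₀]
  have hfin : (q '' closedBall x₀ R).Finite := by
    have h := Measure.finite_const_le_meas_of_disjoint_iUnion ν hH
      (As := fun i : q '' closedBall x₀ R => q ⁻¹' {(i : ι)}) (fun i => hqm i)
      (fun i j hij => hdisj (Subtype.coe_ne_coe.2 hij))
      (ne_top_of_le_ne_top (isCompact_closedBall x₀ (R + 2 * δ)).measure_lt_top.ne
        (measure_mono (Set.iUnion_subset fun i => hsub i i.2)))
    simp only [hq, le_refl, Set.ofPred_true] at h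
    exact Set.finite_coe_iff.1 (Set.finite_univ_iff.1 h)
  refine ⟨hfin.toFinset, fun x hx => ?_, ?_⟩
  · simp only [Set.mem_iUnion]
    exact ⟨q x, hfin.mem_toFinset.2 ⟨x, hx, rfl⟩, rfl⟩
  · rw [← measureReal_biUnion_finset (fun i _ j _ hij => hdisj hij) (fun i _ => hqm i)
      fun i _ => ne_top_of_le_ne_top (isCompact_closedBall _ _).measure_lt_top.ne
        (measure_mono (hqp i))]
    exact measureReal_mono (Set.iUnion₂_subset fun i hi => hsub i (hfin.mem_toFinset.1 hi))
      (isCompact_closedBall _ _).measure_lt_top.ne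

lemma min_one_mul_le {r w : ℝ} (hr : 0 < r) (hw : 0 < w) : min 1 (2 * r / w) * (r + w) ≤ 3 * r := by
  have h1 : min 1 (2 * r / w) * r ≤ 1 * r := mul_le_mul_of_nonneg_right (min_le_left _ _) hr.le
  have h2 : min 1 (2 * r / w) * w ≤ 2 * r / w * w :=
    mul_le_mul_of_nonneg_right (min_le_right _ _) hw.le
  rw [div_mul_cancel₀ _ hw.ne'] at h2
  linarith

lemma expanding_factor_le {M η ε X r : ℝ} (hM : 0 < M) (hη : 0 < η) (hη1 : η ≤ 1) (hε : 0 < ε)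
    (hMX : 1 / M ≤ 2 * X) (hr : 0 < r) :
    1 / M * min 1 (2 * r / (η * ε / M)) * (2 * (M * (r + η * ε / M)) + 1) ≤
      6 / η * (r + min X (r / ε)) := by
  have hw : 0 < η * ε / M := by positivity
  set A := min 1 (2 * r / (η * ε / M)) with hA
  have hA1 : A ≤ 1 := min_le_left _ _
  have hA2 : A ≤ 2 * r / (η * ε / M) := min_le_right _ _
  have h1 : A * (r + η * ε / M) ≤ 3 * r := min_one_mul_le hr hw
  have h2 : 1 / M * A ≤ 2 / η * min X (r / ε) := by
    rw [mul_min_of_nonneg _ _ (show 0 ≤ 2 / η by positivity)]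
    refine le_min ?_ ?_
    · calc 1 / M * A ≤ 1 / M * 1 := by gcongr
        _ ≤ 2 * X := by rw [mul_one]; exact hMX
        _ ≤ 2 / η * X := by
          have : 0 < X := by have := one_div_pos.2 hM; linarith
          gcongr
          rw [le_div_iff₀ hη]; linarith
    · calc 1 / M * A ≤ 1 / M * (2 * r / (η * ε / M)) := by gcongr
        _ = _ := by field_simp
  have h3 : 1 / M * A * (2 * (M * (r + η * ε / M)) + 1) =
      2 * (A * (r + η * ε / M)) + 1 / M * A := by field_simp
  have h4 : 6 * r ≤ 6 / η * r := by
    gcongr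
    rw [le_div_iff₀ hη]; linarith
  have h5 : 0 ≤ 2 / η * min X (r / ε) := h2.trans' (by positivity)
  rw [h3]
  calc _ ≤ 2 * (3 * r) + 2 / η * min X (r / ε) := by gcongr
    _ ≤ 6 / η * r + 3 * (2 / η * min X (r / ε)) := by linarith
    _ = _ := by ring

lemma hyperbolic_factor_le {G Λ η ε Y r : ℝ} (hG : 0 < G) (hΛ : 0 < Λ) (hη : 0 < η) (hη1 : η ≤ 1)
    (hε : 0 < ε) (hGY : 1 / G ^ 2 ≤ 2 * Y) (hGΛ : Λ ≤ 2 * G ^ 2) (hr : 0 < r) :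
    1 / G ^ 2 * (min 1 (2 * r / (η * ε / Λ)) * min 1 (2 * r / (η * ε))) *
      (4 * (G * (r + η * ε / Λ) * (G * (r + η * ε))) + 1) ≤
      36 / η ^ 2 * (r ^ 2 + min Y (min (Y * (r / ε)) ((r / ε) ^ 2))) := by
  have hw₁ : 0 < η * ε / Λ := by positivity
  have hw₂ : 0 < η * ε := by positivity
  set A := min 1 (2 * r / (η * ε / Λ)) with hA
  set B := min 1 (2 * r / (η * ε)) with hB
  have hA0 : 0 ≤ A := by positivity
  have hB0 : 0 ≤ B := by positivity
  have hA1 : A ≤ 1 := min_le_left _ _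
  have hB1 : B ≤ 1 := min_le_left _ _
  have hA2 : A ≤ 2 * r / (η * ε / Λ) := min_le_right _ _
  have hB2 : B ≤ 2 * r / (η * ε) := min_le_right _ _
  have hA3 : A * (r + η * ε / Λ) ≤ 3 * r := min_one_mul_le hr hw₁
  have hB3 : B * (r + η * ε) ≤ 3 * r := min_one_mul_le hr hw₂
  have hY : 0 < Y := by have := one_div_pos.2 (pow_pos hG 2); linarith
  have hη2 : 1 / η ≤ 1 / η ^ 2 := one_div_le_one_div_of_le (by positivity) (by nlinarith)
  have hη3 : 1 ≤ 1 / η ^ 2 := by rw [le_div_iff₀ (by positivity)]; nlinarith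
  have h2 : 1 / G ^ 2 * (A * B) ≤ 8 / η ^ 2 * min Y (min (Y * (r / ε)) ((r / ε) ^ 2)) := by
    have h8 : 0 ≤ 8 / η ^ 2 := by positivity
    rw [mul_min_of_nonneg _ _ h8, mul_min_of_nonneg _ _ h8]
    refine le_min ?_ (le_min ?_ ?_)
    · calc 1 / G ^ 2 * (A * B) ≤ 2 * Y * (1 * 1) := by
            gcongr
        _ ≤ 8 * (1 / η ^ 2) * Y := by nlinarith
        _ = _ := by ring
    · calc 1 / G ^ 2 * (A * B) ≤ 2 * Y * (1 * (2 * r / (η * ε))) := by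
            gcongr
        _ = 4 * (1 / η) * (Y * (r / ε)) := by field_simp; ring
        _ ≤ 8 * (1 / η ^ 2) * (Y * (r / ε)) := by gcongr; norm_num
        _ = _ := by ring
    · calc 1 / G ^ 2 * (A * B) ≤ 1 / G ^ 2 * (2 * r / (η * ε / Λ) * (2 * r / (η * ε))) := by
            gcongr
        _ = 4 / η ^ 2 * (r / ε) ^ 2 * (Λ / G ^ 2) := by field_simp; ring
        _ ≤ 4 / η ^ 2 * (r / ε) ^ 2 * 2 := by
            gcongr
            rwa [div_le_iff₀ (by positivity)]
        _ = _ := by ring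
  have h3 : 1 / G ^ 2 * (A * B) * (4 * (G * (r + η * ε / Λ) * (G * (r + η * ε))) + 1) =
      4 * (A * (r + η * ε / Λ) * (B * (r + η * ε))) + 1 / G ^ 2 * (A * B) := by field_simp
  have h5 : 0 ≤ min Y (min (Y * (r / ε)) ((r / ε) ^ 2)) := by positivity
  rw [h3]
  calc _ ≤ 4 * (3 * r * (3 * r)) + 8 / η ^ 2 * min Y (min (Y * (r / ε)) ((r / ε) ^ 2)) := by
        gcongr
    _ ≤ 36 * (1 / η ^ 2) * r ^ 2 + 36 / η ^ 2 * min Y (min (Y * (r / ε)) ((r / ε) ^ 2)) := by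
        refine add_le_add ?_ ?_
        · nlinarith [sq_nonneg r]
        · gcongr; norm_num
    _ = _ := by ring

section cells

variable (Θ : (ℝ × ℝ) ≃L[ℝ] (ℝ × ℝ)) (M G : ℝ)

/-- The centre of the cell with index `i` in the lattice spanned by `1 / M` and by the image of
`1 / G • ℤ²` under `Θ`. -/
noncomputable def cellCenter (i : ℤ × ℤ × ℤ) : ℝ × ℝ × ℝ :=
  (i.1 / M, G⁻¹ • Θ ((i.2.1 : ℝ), (i.2.2 : ℝ)))

/-- The index of the cell containing a point. -/
noncomputable def cellIndex (x : ℝ × ℝ × ℝ) : ℤ × ℤ × ℤ :=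
  (⌊M * x.1⌋, ⌊G * (Θ.symm x.2).1⌋, ⌊G * (Θ.symm x.2).2⌋)

lemma measurableSet_cell (i : ℤ × ℤ × ℤ) : MeasurableSet (cellIndex Θ M G ⁻¹' {i}) := by
  have h : Measurable (cellIndex Θ M G) := by
    have := Θ.symm.continuous.measurable
    unfold cellIndex
    fun_prop
  exact h (measurableSet_singleton i)

/-- The determinant of `Θ`, up to sign. -/
noncomputable def covol : ℝ := |(LinearMap.det (Θ.symm : ℝ × ℝ →ₗ[ℝ] ℝ × ℝ))⁻¹|

lemma covol_pos : 0 < covol Θ :=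
  abs_pos.2 (inv_ne_zero Θ.symm.toLinearEquiv.isUnit_det'.ne_zero)

variable {M G}

lemma volume_cell (hM : 0 < M) (hG : 0 < G) (i : ℤ × ℤ × ℤ) :
    volume (cellIndex Θ M G ⁻¹' {i}) = ENNReal.ofReal (covol Θ / (M * G ^ 2)) := by
  have hset : cellIndex Θ M G ⁻¹' {i} = ((M * ·) ⁻¹' Set.Ico (i.1 : ℝ) (i.1 + 1)) ×ˢ
      ((G • (Θ.symm : ℝ × ℝ →ₗ[ℝ] ℝ × ℝ)) ⁻¹'
        (Set.Ico (i.2.1 : ℝ) (i.2.1 + 1) ×ˢ Set.Ico (i.2.2 : ℝ) (i.2.2 + 1))) := by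
    ext x
    simp [cellIndex, Prod.ext_iff, Int.floor_eq_iff]
  have hdet : LinearMap.det (G • (Θ.symm : ℝ × ℝ →ₗ[ℝ] ℝ × ℝ)) =
      G ^ 2 * LinearMap.det (Θ.symm : ℝ × ℝ →ₗ[ℝ] ℝ × ℝ) := by
    rw [LinearMap.det_smul]; simp
  have h0 : LinearMap.det (Θ.symm : ℝ × ℝ →ₗ[ℝ] ℝ × ℝ) ≠ 0 :=
    Θ.symm.toLinearEquiv.isUnit_det'.ne_zero
  rw [hset, Measure.volume_eq_prod, Measure.prod_prod, Real.volume_preimage_mul_left hM.ne',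
    Measure.addHaar_preimage_linearMap _ (by rw [hdet]; positivity), hdet, Measure.volume_eq_prod,
    Measure.prod_prod]
  simp only [Real.volume_Ico, add_sub_cancel_left, ENNReal.ofReal_one, mul_one]
  rw [← ENNReal.ofReal_mul (abs_nonneg _), covol, mul_inv, abs_mul, abs_of_pos (inv_pos.2 hM),
    abs_of_pos (inv_pos.2 (pow_pos hG 2))]
  congr 1
  field_simp

lemma cell_subset_closedBall (hM : 0 < M) (hG : 0 < G) (i : ℤ × ℤ × ℤ) :
    cellIndex Θ M G ⁻¹' {i} ⊆
    closedBall (cellCenter Θ M G i) (1 / M + ‖(Θ : ℝ × ℝ →L[ℝ] ℝ × ℝ)‖ / G) := by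
  rintro ⟨x, q⟩ hx
  simp only [cellIndex, Set.mem_preimage, Set.mem_singleton_iff, Prod.ext_iff,
    Int.floor_eq_iff] at hx
  obtain ⟨⟨a1, a2⟩, ⟨b1, b2⟩, c1, c2⟩ := hx
  rw [mem_closedBall, cellCenter, Prod.dist_eq, max_le_iff]
  constructor
  · have : |x - i.1 / M| ≤ 1 / M :=
      abs_sub_div_le hM le_rfl (abs_le.2 ⟨by linarith, by linarith⟩)
    exact this.trans (le_add_of_nonneg_right (by positivity))
  · have h1 : q - G⁻¹ • Θ ((i.2.1 : ℝ), (i.2.2 : ℝ)) =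
        G⁻¹ • Θ (G • Θ.symm q - ((i.2.1 : ℝ), (i.2.2 : ℝ))) := by
      rw [map_sub, map_smul, Θ.apply_symm_apply, smul_sub, smul_smul, inv_mul_cancel₀ hG.ne',
        one_smul]
    have h2 : ‖G • Θ.symm q - ((i.2.1 : ℝ), (i.2.2 : ℝ))‖ ≤ 1 := by
      rw [Prod.norm_def, max_le_iff]
      simp only [Prod.fst_sub, Prod.snd_sub, Prod.smul_fst, Prod.smul_snd, smul_eq_mul,
        Real.norm_eq_abs, abs_le]
      refine ⟨⟨?_, ?_⟩, ?_, ?_⟩ <;> linarith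
    have h3 := (Θ : ℝ × ℝ →L[ℝ] ℝ × ℝ).le_opNorm (G • Θ.symm q - ((i.2.1 : ℝ), (i.2.2 : ℝ)))
    simp only
    rw [dist_eq_norm, h1, norm_smul, norm_inv, Real.norm_of_nonneg hG.le, inv_mul_eq_div]
    have h4 : ‖Θ (G • Θ.symm q - ((i.2.1 : ℝ), (i.2.2 : ℝ)))‖ ≤
        ‖(Θ : ℝ × ℝ →L[ℝ] ℝ × ℝ)‖ :=
      h3.trans (mul_le_of_le_one_right (norm_nonneg _) h2)
    have h5 : 0 ≤ 1 / M := by positivity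
    have h6 := div_le_div_of_nonneg_right h4 hG.le
    linarith

end cells

/-- The mass of a ball for the bumps of half side lengths `η ε / M`, `η ε / Λ`, `η ε` around the
centres of the cells. -/
lemma setIntegral_cells_le {Θ : (ℝ × ℝ) ≃L[ℝ] (ℝ × ℝ)} {U S : ℤ × ℤ → ℝ}
    (hΘ : ∀ v : ℤ × ℤ, Θ ((v.1 : ℝ), (v.2 : ℝ)) = (U v, S v))
    (hUS : ∀ v, v ≠ 0 → 1 ≤ |U v * S v|) {M G Λ η ε X Y r : ℝ} (hM : 0 < M) (hG : 0 < G)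
    (hΛ : 0 < Λ) (hη : 0 < η) (hη1 : η ≤ 1) (hε : 0 < ε) (hMX : 1 / M ≤ 2 * X)
    (hGY : 1 / G ^ 2 ≤ 2 * Y) (hGΛ : Λ ≤ 2 * G ^ 2) (hr : 0 < r) (W : Finset (ℤ × ℤ × ℤ))
    (x : ℝ × ℝ × ℝ) :
    ∫ y in closedBall x r, ∑ i ∈ W, covol Θ / (M * G ^ 2) *
      boxBump (η * ε / M, η * ε / Λ, η * ε) (cellCenter Θ M G i) y ≤
      covol Θ * (6 / η) * (36 / η ^ 2) * ((r + min X (r / ε)) *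
        (r ^ 2 + min Y (min (Y * (r / ε)) ((r / ε) ^ 2)))) := by
  have hκ := covol_pos Θ
  have hsub : ∀ v w, (U (v - w), S (v - w)) = (U v, S v) - (U w, S w) := fun v w => by
    rw [← hΘ, ← hΘ, ← hΘ, ← map_sub]; simp
  have hU : ∀ v w, U (v - w) = U v - U w := fun v w => congrArg Prod.fst (hsub v w)
  have hS : ∀ v w, S (v - w) = S v - S w := fun v w => congrArg Prod.snd (hsub v w)
  refine (setIntegral_sum_boxBump_le (N := (2 * (M * (r + η * ε / M)) + 1) *
    (4 * (G * (r + η * ε / Λ) * (G * (r + η * ε))) + 1)) (w := (η * ε / M, η * ε / Λ, η * ε))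
    (by positivity) (by positivity) (by positivity) W (cellCenter Θ M G)
    (by positivity : 0 ≤ covol Θ / (M * G ^ 2)) hr x fun V _ hV => ?_).trans ?_
  · have hscale : ∀ {a x k e : ℝ}, 0 < a → |x - k / a| ≤ e → |k - a * x| ≤ a * e :=
      fun {a x k e} ha h => by
      have : k - a * x = -(a * (x - k / a)) := by field_simp; ring
      rw [this, abs_neg, abs_mul, abs_of_pos ha]
      exact mul_le_mul_of_nonneg_left h ha.le
    have hc : V ⊆ V.image Prod.fst ×ˢ V.image Prod.snd := Finset.subset_product
    have hc1 := Finset.card_le_card hc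
    rw [Finset.card_product] at hc1
    have h1 : ((V.image Prod.fst).card : ℝ) ≤ 2 * (M * (r + η * ε / M)) + 1 := by
      refine card_le_of_abs_sub_le (y := M * x.1) (by positivity) fun j hj => ?_
      obtain ⟨i, hi, rfl⟩ := Finset.mem_image.1 hj
      exact hscale hM (hV i hi).1
    have h2 : ((V.image Prod.snd).card : ℝ) ≤
        4 * (G * (r + η * ε / Λ) * (G * (r + η * ε))) + 1 := by
      refine card_le_of_forms hU hS hUS (u₀ := G * x.2.1) (s₀ := G * x.2.2) (by positivity)
        (by positivity) (fun v hv => ?_) (fun v hv => ?_) <;>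
      obtain ⟨i, hi, rfl⟩ := Finset.mem_image.1 hv
      · refine hscale hG ?_
        have := (hV i hi).2.1
        rwa [cellCenter, hΘ, Prod.smul_fst, smul_eq_mul, inv_mul_eq_div] at this
      · refine hscale hG ?_
        have := (hV i hi).2.2
        rwa [cellCenter, hΘ, Prod.smul_snd, smul_eq_mul, inv_mul_eq_div] at this
    calc (V.card : ℝ) ≤ (V.image Prod.fst).card * (V.image Prod.snd).card := by exact_mod_cast hc1
      _ ≤ _ := by gcongr
  · have h1 := expanding_factor_le hM hη hη1 hε hMX hr
    have h2 := hyperbolic_factor_le hG hΛ hη hη1 hε hGY hGΛ hr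
    calc _ = covol Θ * ((1 / M * min 1 (2 * r / (η * ε / M)) *
            (2 * (M * (r + η * ε / M)) + 1)) * (1 / G ^ 2 * (min 1 (2 * r / (η * ε / Λ)) *
            min 1 (2 * r / (η * ε))) * (4 * (G * (r + η * ε / Λ) * (G * (r + η * ε))) + 1))) := by
          rw [div_mul_eq_mul_div]; field_simp
      _ ≤ covol Θ * (6 / η * (r + min X (r / ε)) *
            (36 / η ^ 2 * (r ^ 2 + min Y (min (Y * (r / ε)) ((r / ε) ^ 2))))) := by
          gcongr
          exact h1.trans' (by positivity)
      _ = _ := by ring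

lemma isClosed_box (w p : ℝ × ℝ × ℝ) : IsClosed {x : ℝ × ℝ × ℝ |
    |x.1 - p.1| ≤ w.1 ∧ |x.2.1 - p.2.1| ≤ w.2.1 ∧ |x.2.2 - p.2.2| ≤ w.2.2} := by
  simp only [Set.ofPred_and]
  exact (isClosed_le (by fun_prop) (by fun_prop)).inter ((isClosed_le (by fun_prop)
    (by fun_prop)).inter (isClosed_le (by fun_prop) (by fun_prop)))

/-- The rate `l ^ k - l⁻¹ ^ k` of the lattice of points of period `2 * k`. -/
lemma sub_inv_bounds {L : ℝ} (hL : 2 ≤ L) : 0 < L - L⁻¹ ∧ L ^ 2 - 1 ≤ 2 * (L - L⁻¹) ^ 2 ∧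
    1 / (L - L⁻¹) ^ 2 ≤ 2 * (1 / L ^ 2) ∧ L ^ 2 - 1 = L * (L - L⁻¹) ∧
    1 - L⁻¹ ^ 2 = L⁻¹ * (L - L⁻¹) := by
  have hL0 : 0 < L := by linarith
  have h1 : L * L⁻¹ = 1 := mul_inv_cancel₀ hL0.ne'
  have h2 : L⁻¹ ≤ 2⁻¹ := inv_anti₀ (by norm_num) hL
  have h3 : 0 < L - L⁻¹ := by linarith
  have h4 : L ^ 2 ≤ 2 * (L - L⁻¹) ^ 2 := by nlinarith [sq_nonneg L⁻¹]
  refine ⟨h3, by linarith, ?_, by linear_combination h1, by linear_combination -h1⟩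
  rw [mul_one_div, div_le_div_iff₀ (by positivity) (by positivity)]
  linarith

lemma iterate_smul {f : ℤ × ℤ → ℝ} {σ : ℤ × ℤ → ℤ × ℤ} {a : ℝ} (h : ∀ v, f (σ v) = a * f v)
    (k : ℕ) (v : ℤ × ℤ) : f (σ^[k] v) = a ^ k * f v := by
  induction k with
  | zero => simp
  | succ k ih => rw [Function.iterate_succ_apply', h, ih, pow_succ']; ring

theorem le_dimH_eigenRecSet {m l τ c s : ℝ} {U S : ℤ × ℤ → ℝ} {Θ : (ℝ × ℝ) ≃L[ℝ] (ℝ × ℝ)}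
    (hΘ : ∀ v : ℤ × ℤ, Θ ((v.1 : ℝ), (v.2 : ℝ)) = (U v, S v))
    (hUS : ∀ v, v ≠ 0 → 1 ≤ |U v * S v|) {σ : ℤ × ℤ → ℤ × ℤ} (hσU : ∀ v, U (σ v) = l * U v)
    (hσS : ∀ v, S (σ v) = l⁻¹ * S v) (hm : 2 ≤ m) (hml : m ≤ l)
    (hlm : Real.log l < 2 * Real.log m) (hτ : 0 < τ) (hc : 0 < c)
    (hs1 : s * (τ + Real.log m) ≤ 2 * Real.log m + Real.log l)
    (hs2 : s * (τ + Real.log l) ≤ 3 * Real.log l)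
    (hs3 : s * τ ≤ Real.log l + Real.log m) (hs4 : s * τ ≤ τ + Real.log l) :
    ENNReal.ofReal s ≤ dimH (eigenRecSet m l U S τ c) := by
  have hl : 2 ≤ l := hm.trans hml
  have h2 : 0 < Real.log m := Real.log_pos (by linarith)
  have h12 : Real.log m ≤ Real.log l := Real.log_le_log (by linarith) hml
  have hκ := covol_pos Θ
  obtain ⟨η, hη, hη1, hηc⟩ : ∃ η : ℝ, 0 < η ∧ η ≤ 1 ∧ η < c :=
    ⟨min 1 (c / 2), lt_min one_pos (half_pos hc), min_le_left _ _,
      (min_le_right _ _).trans_lt (half_lt_self hc)⟩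
  set M : ℕ → ℝ := fun k => m ^ (2 * (k + 1)) - 1 with hMdef
  set Λ : ℕ → ℝ := fun k => l ^ (2 * (k + 1)) - 1 with hΛdef
  set G : ℕ → ℝ := fun k => l ^ (k + 1) - (l ^ (k + 1))⁻¹ with hGdef
  set ε : ℕ → ℝ := fun k => Real.exp (-((2 * (k + 1) : ℕ) * τ)) with hεdef
  set w : ℕ → ℝ × ℝ × ℝ := fun k => (η * ε k / M k, η * ε k / Λ k, η * ε k) with hw
  have hL : ∀ k, 2 ≤ l ^ (k + 1) := fun k => hl.trans (le_self_pow₀ (by linarith) (by omega))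
  have hLsq : ∀ k, l ^ (2 * (k + 1)) = (l ^ (k + 1)) ^ 2 := fun k => by
    rw [← pow_mul, mul_comm]
  have hM1 : ∀ k, 1 ≤ M k := fun k => by
    have : m ≤ m ^ (2 * (k + 1)) := le_self_pow₀ (by linarith) (by omega)
    simp only [hMdef]; linarith
  have hΛ1 : ∀ k, 1 ≤ Λ k := fun k => by
    have : l ≤ l ^ (2 * (k + 1)) := le_self_pow₀ (by linarith) (by omega)
    simp only [hΛdef]; linarith
  have hM0 : ∀ k, 0 < M k := fun k => one_pos.trans_le (hM1 k)
  have hΛ0 : ∀ k, 0 < Λ k := fun k => one_pos.trans_le (hΛ1 k)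
  have hε0 : ∀ k, 0 < ε k := fun k => Real.exp_pos _
  have hG := fun k => sub_inv_bounds (hL k)
  have hG0 : ∀ k, 0 < G k := fun k => (hG k).1
  have hw1 : ∀ k, 0 < (w k).1 := fun k => div_pos (mul_pos hη (hε0 k)) (hM0 k)
  have hw2 : ∀ k, 0 < (w k).2.1 := fun k => div_pos (mul_pos hη (hε0 k)) (hΛ0 k)
  have hw3 : ∀ k, 0 < (w k).2.2 := fun k => mul_pos hη (hε0 k)
  have hηε : ∀ k, η * ε k ≤ ε k := fun k => mul_le_of_le_one_left (hε0 k).le hη1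
  have hexpn : ∀ {y : ℝ}, 0 < y → ∀ k : ℕ,
      Real.exp (-((2 * (k + 1) : ℕ) * Real.log y)) = 1 / y ^ (2 * (k + 1)) := fun {y} hy k => by
    rw [Real.exp_neg, exp_mul_log hy, one_div]
  set δ : ℕ → ℝ := fun k => 1 / M k + ‖(Θ : ℝ × ℝ →L[ℝ] ℝ × ℝ)‖ / G k + ε k with hδdef
  have hε_le : ∀ k, ε k ≤ δ k := fun k => by
    have h3 := one_div_pos.2 (hM0 k)
    have h4 : 0 ≤ ‖(Θ : ℝ × ℝ →L[ℝ] ℝ × ℝ)‖ / G k := div_nonneg (norm_nonneg _) (hG0 k).le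
    simp only [hδdef]; linarith
  have hδ : Tendsto δ atTop (𝓝 0) := by
    have hsucc : Tendsto (fun k : ℕ => k + 1) atTop atTop := tendsto_add_atTop_nat 1
    have hdbl : Tendsto (fun k : ℕ => 2 * (k + 1)) atTop atTop :=
      hsucc.const_mul_atTop' two_pos
    have hMt : Tendsto M atTop atTop := tendsto_atTop_add_const_right _ (-1)
      ((tendsto_pow_atTop_atTop_of_one_lt (by linarith : 1 < m)).comp hdbl)
    have hGt : Tendsto G atTop atTop := by
      refine tendsto_atTop_mono (fun k => ?_) (tendsto_atTop_add_const_right _ (-1)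
        ((tendsto_pow_atTop_atTop_of_one_lt (by linarith : 1 < l)).comp hsucc))
      have : (l ^ (k + 1))⁻¹ ≤ 1 := inv_le_one_of_one_le₀ (by linarith [hL k])
      simp only [hGdef, Function.comp_apply]; linarith
    have hεt : Tendsto ε atTop (𝓝 0) := by
      refine Real.tendsto_exp_atBot.comp (tendsto_neg_atTop_atBot.comp ?_)
      exact (tendsto_natCast_atTop_atTop.comp hdbl).atTop_mul_const hτ
    have := ((tendsto_const_nhds (x := (1 : ℝ))).div_atTop hMt).add
      ((tendsto_const_nhds (x := ‖(Θ : ℝ × ℝ →L[ℝ] ℝ × ℝ)‖)).div_atTop hGt) |>.add hεt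
    simpa only [add_zero] using this
  obtain ⟨D, hD⟩ := hδ.bddAbove_range
  have hcells : ∀ k i, cellIndex Θ (M k) (G k) ⁻¹' {i} ⊆
      closedBall (cellCenter Θ (M k) (G k) i) (δ k) := fun k i =>
    (cell_subset_closedBall Θ (hM0 k) (hG0 k) i).trans
      (closedBall_subset_closedBall (le_add_of_nonneg_right (hε0 k).le))
  choose W hWcov hWvol using fun k => exists_finset_cells (ν := volume)
    (cellIndex Θ (M k) (G k)) (measurableSet_cell Θ (M k) (G k)) (hcells k)
    (ENNReal.ofReal_pos.2 (div_pos hκ (mul_pos (hM0 k) (pow_pos (hG0 k) 2))))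
    (volume_cell Θ (hM0 k) (hG0 k)) (0 : ℝ × ℝ × ℝ) 1
  set H : ℕ → ℝ := fun k => covol Θ / (M k * G k ^ 2) with hHdef
  have hH0 : ∀ k, 0 ≤ H k := fun k => div_nonneg hκ.le (by have := hM0 k; positivity)
  set β : ℕ → ℤ × ℤ × ℤ → ℝ × ℝ × ℝ → ℝ := fun k i x =>
    H k * boxBump (w k) (cellCenter Θ (M k) (G k) i) x with hβ
  have hβc : ∀ k i, Continuous (β k i) := fun k i => (continuous_boxBump _ _).const_mul _
  have hβ0 : ∀ k i x, 0 ≤ β k i x := fun k i x =>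
    mul_nonneg (hH0 k) (boxBump_nonneg (hw1 k) (hw2 k) (hw3 k) _ x)
  have hβz : ∀ k i x, ¬ (|x.1 - (cellCenter Θ (M k) (G k) i).1| ≤ (w k).1 ∧
      |x.2.1 - (cellCenter Θ (M k) (G k) i).2.1| ≤ (w k).2.1 ∧
      |x.2.2 - (cellCenter Θ (M k) (G k) i).2.2| ≤ (w k).2.2) → β k i x = 0 := fun k i x hx => by
    simp only [hβ, boxBump_eq_zero (hw1 k) (hw2 k) (hw3 k) _ hx, mul_zero]
  set K : ℕ → Set (ℝ × ℝ × ℝ) := fun k => ⋃ i ∈ W k, {x : ℝ × ℝ × ℝ |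
    |x.1 - (cellCenter Θ (M k) (G k) i).1| ≤ (w k).1 ∧
    |x.2.1 - (cellCenter Θ (M k) (G k) i).2.1| ≤ (w k).2.1 ∧
    |x.2.2 - (cellCenter Θ (M k) (G k) i).2.2| ≤ (w k).2.2} with hK
  have hsub : {x | ∃ᶠ k in atTop, x ∈ K k} ⊆ eigenRecSet m l U S τ c := by
    intro x hx
    have hdbl : Tendsto (fun k : ℕ => 2 * (k + 1)) atTop atTop :=
      (tendsto_add_atTop_nat 1).const_mul_atTop' two_pos
    refine hdbl.frequently (hx.mono fun k hk => ?_)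
    simp only [hK, Set.mem_iUnion, exists_prop] at hk
    obtain ⟨⟨j, v⟩, -, h3, h4, h5⟩ := hk
    simp only [cellCenter, hΘ, Prod.smul_fst, Prod.smul_snd, smul_eq_mul, hw] at h3 h4 h5
    have hlt : η * ε k < c * ε k := mul_lt_mul_of_pos_right hηc (hε0 k)
    have hscale : ∀ {a b x p e : ℝ}, 0 < a → |x - p| ≤ e → a * p = b → |a * x - b| ≤ a * e :=
      fun {a b x p e} ha h hb => by
        rw [← hb, ← mul_sub, abs_mul, abs_of_pos ha]
        exact mul_le_mul_of_nonneg_left h ha.le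
    obtain ⟨-, -, -, g1, g2⟩ := hG k
    refine ⟨j, σ^[k + 1] v, ?_, ?_, ?_⟩
    · refine (hscale (hM0 k) h3 (mul_div_cancel₀ _ (hM0 k).ne')).trans_lt ?_
      rwa [mul_div_cancel₀ _ (hM0 k).ne']
    · rw [iterate_smul hσU]
      refine (hscale (hΛ0 k) h4 ?_).trans_lt ?_
      · simp only [hΛdef]
        rw [hLsq, g1, mul_assoc, mul_inv_cancel_left₀ (hG0 k).ne']
      · rwa [mul_div_cancel₀ _ (hΛ0 k).ne']
    · rw [iterate_smul hσS, inv_pow, inv_pow, hLsq, ← inv_pow, g2]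
      have h6 : 0 < (l ^ (k + 1))⁻¹ * (l ^ (k + 1) - (l ^ (k + 1))⁻¹) :=
        mul_pos (inv_pos.2 (by linarith [hL k])) (hG0 k)
      refine (hscale h6 h5 ?_).trans_lt (lt_of_le_of_lt ?_ hlt)
      · rw [mul_assoc, mul_inv_cancel_left₀ (hG0 k).ne']
      · rw [← g2]
        exact mul_le_of_le_one_left (mul_pos hη (hε0 k)).le
          (by linarith [sq_nonneg (l ^ (k + 1))⁻¹])
  refine le_trans ?_ (dimH_mono hsub)
  refine le_dimH_frequently_of_densities (ν := volume) (isCompact_closedBall (0 : ℝ × ℝ × ℝ) 1)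
    (f := fun k x => ∑ i ∈ W k, β k i x) (fun k => continuous_finsetSum _ fun i _ => hβc k i)
    (fun k x => Finset.sum_nonneg fun i _ => hβ0 k i x)
    (fun k => (W k).finite_toSet.isClosed_biUnion fun i _ => isClosed_box _ _)
    (fun k x hx => Finset.sum_eq_zero fun i hi => hβz k i x fun h =>
      hx (Set.mem_biUnion hi h))
    (C := covol Θ * (6 / η) * (36 / η ^ 2) * 4) (by positivity) (fun k x r hr hr1 => ?_)
    (fun g hg hgQ => tendsto_integral_mul_sum_bumps (isCompact_closedBall (0 : ℝ × ℝ × ℝ) 1) hδ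
      (fun k i => measurableSet_cell Θ (M k) (G k) i)
      (fun k i j hij => Disjoint.preimage _ (Set.disjoint_singleton.2 hij)) hWcov hcells hβc hβ0
      (fun k i x hx => hβz k i x fun h => hx ?_) (fun k i => ?_)
      (B := volume.real (closedBall (0 : ℝ × ℝ × ℝ) (1 + 2 * D))) (fun k => (hWvol k).trans ?_)
      hg hgQ)
    (χ := boxBump (1, 1, 1) 0) (continuous_boxBump _ _)
    (boxBump_nonneg one_pos one_pos one_pos 0)
    (fun x hx => boxBump_eq_zero one_pos one_pos one_pos 0 fun h => hx ?_)
    (by rw [integral_boxBump one_pos one_pos one_pos]; exact one_pos)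
  · refine (setIntegral_cells_le hΘ hUS (hM0 k) (hG0 k) (hΛ0 k) hη hη1 (hε0 k)
      (X := Real.exp (-((2 * (k + 1) : ℕ) * Real.log m)))
      (Y := Real.exp (-((2 * (k + 1) : ℕ) * Real.log l))) ?_ ?_ ?_ hr (W k) x).trans ?_
    · rw [hexpn (by linarith), mul_one_div, div_le_div_iff₀ (hM0 k) (by positivity)]
      linarith [half_pow_le_sub_one hm (n := 2 * (k + 1)) (by omega)]
    · rw [hexpn (by linarith), hLsq]
      exact (hG k).2.2.1
    · simp only [hΛdef]
      rw [hLsq]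
      exact (hG k).2.1
    · rw [mul_assoc _ (4 : ℝ)]
      exact mul_le_mul_of_nonneg_left (ball_mass_le_rpow h2 h12 hlm hτ hs1 hs2 hs3 hs4
        (Nat.cast_pos.2 (by omega)) hr hr1) (by positivity)
  · rw [mem_closedBall, Prod.dist_eq, Prod.dist_eq, max_le_iff, max_le_iff]
    have h3 := (hηε k).trans (hε_le k)
    have h4 := mul_pos hη (hε0 k)
    exact ⟨h.1.trans ((div_le_self h4.le (hM1 k)).trans h3),
      h.2.1.trans ((div_le_self h4.le (hΛ1 k)).trans h3), h.2.2.trans h3⟩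
  · rw [integral_const_mul, integral_boxBump (hw1 k) (hw2 k) (hw3 k), mul_one, measureReal_def,
      volume_cell Θ (hM0 k) (hG0 k), ENNReal.toReal_ofReal (hH0 k)]
  · exact measureReal_mono (closedBall_subset_closedBall (by linarith [hD ⟨k, rfl⟩]))
      (isCompact_closedBall _ _).measure_lt_top.ne
  · rw [mem_closedBall, Prod.dist_eq, Prod.dist_eq, max_le_iff, max_le_iff]
    exact h

section eigen

variable {a b c d : ℤ} {l : ℝ}

lemma inv_eq_trace_sub (hl : l ^ 2 - ((a : ℝ) + d) * l + 1 = 0) :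
    l⁻¹ = a + d - l := by
  rw [inv_eq_iff_eq_inv, eq_comm]
  refine inv_eq_of_mul_eq_one_left ?_
  linear_combination -hl

lemma three_le_trace (hl1 : 1 < l) (hl : l ^ 2 - ((a : ℝ) + d) * l + 1 = 0) : 3 ≤ a + d := by
  have h : (2 : ℝ) < ((a + d : ℤ) : ℝ) := by
    push_cast
    nlinarith [mul_pos (sub_pos.2 hl1) (sub_pos.2 hl1)]
  have h' : (2 : ℤ) < a + d := by exact_mod_cast h
  omega

lemma irrational_sub_inv (hl1 : 1 < l) (hl : l ^ 2 - ((a : ℝ) + d) * l + 1 = 0) :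
    Irrational (l - l⁻¹) := by
  have hT := three_le_trace hl1 hl
  have hsq : (l - l⁻¹) ^ 2 = (((a + d) ^ 2 - 4 : ℤ) : ℝ) := by
    rw [inv_eq_trace_sub hl]; push_cast; linear_combination 4 * hl
  refine irrational_nrt_of_notint_nrt 2 _ hsq ?_ two_pos
  rintro ⟨y, hy⟩
  rw [hy] at hsq
  have h1 : y ^ 2 = (a + d) ^ 2 - 4 := by exact_mod_cast hsq
  have h2 : |y| < a + d := abs_lt_of_sq_lt_sq (by omega) (by omega)
  have h3 : |y| ≤ a + d - 1 := by omega
  have h4 : y ^ 2 ≤ (a + d - 1) ^ 2 :=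
    sq_le_sq' (by linarith [neg_abs_le y]) ((le_abs_self y).trans h3)
  nlinarith

lemma ne_zero_of_hyperbolic (hdet : a * d - b * c = 1) (hl1 : 1 < l)
    (hl : l ^ 2 - ((a : ℝ) + d) * l + 1 = 0) : c ≠ 0 := by
  rintro rfl
  have hT := three_le_trace hl1 hl
  have h : a * d = 1 := by linarith
  rcases Int.eq_one_or_neg_one_of_mul_eq_one h with rfl | rfl <;> omega

/-- The product of the two eigenforms of the block `[[a, b], [c, d]]` is bounded below on nonzero
integer vectors. -/
lemma one_le_abs_mul_forms (hdet : a * d - b * c = 1) (hl1 : 1 < l)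
    (hl : l ^ 2 - ((a : ℝ) + d) * l + 1 = 0) {v : ℤ × ℤ} (hv : v ≠ 0) :
    1 ≤ |(c * v.1 + (l - a) * v.2) * -(c * v.1 + (l⁻¹ - a) * v.2)| := by
  have hc := ne_zero_of_hyperbolic hdet hl1 hl
  have hinv := inv_eq_trace_sub hl
  have hirr := irrational_sub_inv hl1 hl
  have hdet' : (a : ℝ) * d - b * c = 1 := by exact_mod_cast hdet
  have hInt : (c * v.1 + (l - a) * v.2) * -(c * v.1 + (l⁻¹ - a) * v.2) =
      ((-c * (c * v.1 ^ 2 + (d - a) * (v.1 * v.2) - b * v.2 ^ 2) : ℤ) : ℝ) := by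
    rw [hinv]; push_cast
    linear_combination (v.2 : ℝ) ^ 2 * hl + (v.2 : ℝ) ^ 2 * hdet'
  have hne : (c * v.1 + (l - a) * v.2) * -(c * v.1 + (l⁻¹ - a) * v.2) ≠ 0 := by
    intro h0
    have hv2 : v.2 ≠ 0 := by
      intro h2
      have hv1 : v.1 = 0 := by
        simpa [h2, hc] using h0
      exact hv (Prod.ext hv1 h2)
    have hv2' : (v.2 : ℝ) ≠ 0 := Int.cast_ne_zero.2 hv2
    have hsub : l - l⁻¹ = 2 * l - (a + d) := by rw [hinv]; ring
    have hirr' : Irrational ((v.2 : ℝ) * (l - l⁻¹)) := hirr.intCast_mul hv2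
    rcases mul_eq_zero.1 h0 with h | h
    · refine hirr' ⟨((-2 * c * v.1 + (a - d) * v.2 : ℤ) : ℚ), ?_⟩
      push_cast
      linear_combination -2 * h - (v.2 : ℝ) * hsub
    · refine hirr' ⟨((2 * c * v.1 + (d - a) * v.2 : ℤ) : ℚ), ?_⟩
      push_cast
      rw [hinv] at h ⊢
      linear_combination -2 * h
  rw [hInt] at hne ⊢
  rw [← Int.cast_abs]
  exact_mod_cast Int.one_le_abs (Int.cast_ne_zero.1 hne)

end eigen

/-- The linear equivalence given by two forms `c x + α y` and `-(c x + β y)`. -/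
noncomputable def formsEquiv {c α β : ℝ} (hc : c ≠ 0) (hαβ : α - β ≠ 0) :
    (ℝ × ℝ) ≃L[ℝ] (ℝ × ℝ) :=
  LinearEquiv.toContinuousLinearEquiv
    { toFun := fun y => (c * y.1 + α * y.2, -(c * y.1 + β * y.2))
      map_add' := fun x y => by simp only [Prod.fst_add, Prod.snd_add, Prod.mk_add_mk]; ring_nf
      map_smul' := fun t y => by
        simp only [Prod.smul_fst, Prod.smul_snd, smul_eq_mul, Prod.smul_mk, RingHom.id_apply]
        ring_nf
      invFun := fun p => ((p.1 - α * ((p.1 + p.2) / (α - β))) / c, (p.1 + p.2) / (α - β))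
      left_inv := fun y => by ext <;> simp only <;> field_simp <;> ring
      right_inv := fun p => by ext <;> simp only <;> field_simp <;> ring }

/-- The change of coordinates to `(x₀, c x₁ + α x₂, c x₁ + β x₂)`. -/
noncomputable def eigenCoords {c α β : ℝ} (hc : c ≠ 0) (hαβ : α - β ≠ 0) :
    EuclideanSpace ℝ (Fin 3) ≃L[ℝ] ℝ × ℝ × ℝ :=
  LinearEquiv.toContinuousLinearEquiv
    { toFun := fun x => (x 0, c * x 1 + α * x 2, c * x 1 + β * x 2)
      map_add' := fun x y => by simp only [PiLp.add_apply, Prod.mk_add_mk]; ring_nf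
      map_smul' := fun t y => by
        simp only [PiLp.smul_apply, smul_eq_mul, Prod.smul_mk, RingHom.id_apply]
        ring_nf
      invFun := fun p => !₂[p.1, (p.2.1 - α * ((p.2.1 - p.2.2) / (α - β))) / c,
        (p.2.1 - p.2.2) / (α - β)]
      left_inv := fun x => by
        ext i
        fin_cases i <;> simp
        all_goals field_simp
        ring
      right_inv := fun p => by
        simp
        ext <;> simp <;> field_simp <;> ring }

lemma eigenCoords_apply {c α β : ℝ} (hc : c ≠ 0) (hαβ : α - β ≠ 0) (x : EuclideanSpace ℝ (Fin 3)) :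
    eigenCoords hc hαβ x = (x 0, c * x 1 + α * x 2, c * x 1 + β * x 2) := rfl

lemma toEuclideanLin_pow_map (A : Matrix (Fin 3) (Fin 3) ℤ) (n : ℕ)
    (x : EuclideanSpace ℝ (Fin 3)) :
    Matrix.toEuclideanLin ((A ^ n).map (Int.cast : ℤ → ℝ)) x =
      (Matrix.toEuclideanLin (A.map (Int.cast : ℤ → ℝ)))^[n] x := by
  induction n with
  | zero => simp
  | succ n ih =>
    rw [Function.iterate_succ_apply', ← ih, pow_succ']
    have : (A * A ^ n).map (Int.cast : ℤ → ℝ) = A.map Int.cast * (A ^ n).map Int.cast :=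
      Matrix.map_mul (f := Int.castRingHom ℝ)
    rw [this]
    ext i
    simp [Matrix.mulVec_mulVec]

lemma eigenCoords_toEuclideanLin_pow {m a b c d : ℤ} (hdet : a * d - b * c = 1) {l : ℝ}
    (hl : l ^ 2 - ((a : ℝ) + d) * l + 1 = 0) (hc : (c : ℝ) ≠ 0)
    (hαβ : l - a - (l⁻¹ - a) ≠ 0) {A : Matrix (Fin 3) (Fin 3) ℤ}
    (hA : A = ![![m, 0, 0], ![0, a, b], ![0, c, d]]) (n : ℕ) (x : EuclideanSpace ℝ (Fin 3)) :
    eigenCoords hc hαβ (Matrix.toEuclideanLin ((A ^ n).map (Int.cast : ℤ → ℝ)) x) =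
      (m ^ n * (eigenCoords hc hαβ x).1, l ^ n * (eigenCoords hc hαβ x).2.1,
        l⁻¹ ^ n * (eigenCoords hc hαβ x).2.2) := by
  have hdet' : (a : ℝ) * d - b * c = 1 := by exact_mod_cast hdet
  have hinv := inv_eq_trace_sub hl
  rw [toEuclideanLin_pow_map]
  induction n with
  | zero => simp
  | succ n ih =>
    rw [Function.iterate_succ_apply']
    set y := (Matrix.toEuclideanLin (A.map (Int.cast : ℤ → ℝ)))^[n] x with hy
    have hstep : eigenCoords hc hαβ (Matrix.toEuclideanLin (A.map (Int.cast : ℤ → ℝ)) y) =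
        (m * (eigenCoords hc hαβ y).1, l * (eigenCoords hc hαβ y).2.1,
          l⁻¹ * (eigenCoords hc hαβ y).2.2) := by
      simp only [eigenCoords_apply, Matrix.toLpLin_apply, Matrix.mulVec, dotProduct,
        Fin.sum_univ_three, Matrix.map_apply]
      simp only [hA, Matrix.cons_val, Int.cast_zero, zero_mul, add_zero, zero_add, hinv,
        Prod.mk.injEq, true_and]
      constructor
      · linear_combination (-y 2) * hl - y 2 * hdet'
      · linear_combination (-y 2) * hl - y 2 * hdet'
    rw [hstep, ih]
    simp only [pow_succ']
    ext <;> simp only <;> ring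

lemma eigenCoords_pow_sub_sub {m a b c d : ℤ} (hdet : a * d - b * c = 1) {l : ℝ}
    (hl : l ^ 2 - ((a : ℝ) + d) * l + 1 = 0) (hc : (c : ℝ) ≠ 0)
    (hαβ : l - a - (l⁻¹ - a) ≠ 0) {A : Matrix (Fin 3) (Fin 3) ℤ}
    (hA : A = ![![m, 0, 0], ![0, a, b], ![0, c, d]]) (n : ℕ) (x : EuclideanSpace ℝ (Fin 3))
    (z : Fin 3 → ℤ) :
    eigenCoords hc hαβ (Matrix.toEuclideanLin ((A ^ n).map (Int.cast : ℤ → ℝ)) x - x - intVec3 z) =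
      ((m ^ n - 1) * (eigenCoords hc hαβ x).1 - z 0,
        (l ^ n - 1) * (eigenCoords hc hαβ x).2.1 - (c * z 1 + (l - a) * z 2),
        -((1 - l⁻¹ ^ n) * (eigenCoords hc hαβ x).2.2 - -(c * z 1 + (l⁻¹ - a) * z 2))) := by
  rw [map_sub, map_sub, eigenCoords_toEuclideanLin_pow hdet hl hc hαβ hA]
  simp only [eigenCoords_apply, intVec3, WithLp.equiv_symm_apply]
  ext <;> simp only [Prod.fst_sub, Prod.snd_sub] <;> ring

lemma image_recSet3_subset {m a b c d : ℤ} (hdet : a * d - b * c = 1) {l : ℝ}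
    (hl : l ^ 2 - ((a : ℝ) + d) * l + 1 = 0) (hc : (c : ℝ) ≠ 0)
    (hαβ : l - a - (l⁻¹ - a) ≠ 0) {A : Matrix (Fin 3) (Fin 3) ℤ}
    (hA : A = ![![m, 0, 0], ![0, a, b], ![0, c, d]]) (τ : ℝ) :
    eigenCoords hc hαβ '' recSet3 A τ ⊆
      eigenRecSet m l (fun v => c * v.1 + (l - a) * v.2) (fun v => -(c * v.1 + (l⁻¹ - a) * v.2)) τ
        (‖(eigenCoords hc hαβ : EuclideanSpace ℝ (Fin 3) →L[ℝ] ℝ × ℝ × ℝ)‖ + 1) := by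
  rintro _ ⟨x, hx, rfl⟩
  refine Frequently.mono hx ?_
  rintro n ⟨z, hz⟩
  set Φ := (eigenCoords hc hαβ : EuclideanSpace ℝ (Fin 3) →L[ℝ] ℝ × ℝ × ℝ)
  have hlt : ‖eigenCoords hc hαβ
      (Matrix.toEuclideanLin ((A ^ n).map (Int.cast : ℤ → ℝ)) x - x - intVec3 z)‖ <
        (‖Φ‖ + 1) * Real.exp (-(n * τ)) := by
    rw [neg_mul] at hz
    refine (Φ.le_opNorm _).trans_lt ?_
    nlinarith [norm_nonneg Φ, Real.exp_pos (-(n * τ))]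
  rw [eigenCoords_pow_sub_sub hdet hl hc hαβ hA, Prod.norm_def, Prod.norm_def, max_lt_iff,
    max_lt_iff, norm_neg] at hlt
  exact ⟨z 0, (z 1, z 2), hlt⟩

lemma subset_image_recSet3 {m a b c d : ℤ} (hdet : a * d - b * c = 1) {l : ℝ}
    (hl : l ^ 2 - ((a : ℝ) + d) * l + 1 = 0) (hc : (c : ℝ) ≠ 0)
    (hαβ : l - a - (l⁻¹ - a) ≠ 0) {A : Matrix (Fin 3) (Fin 3) ℤ}
    (hA : A = ![![m, 0, 0], ![0, a, b], ![0, c, d]]) (τ : ℝ) :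
    eigenRecSet m l (fun v => c * v.1 + (l - a) * v.2) (fun v => -(c * v.1 + (l⁻¹ - a) * v.2)) τ
        (‖((eigenCoords hc hαβ).symm : ℝ × ℝ × ℝ →L[ℝ] EuclideanSpace ℝ (Fin 3))‖ + 1)⁻¹ ⊆
      eigenCoords hc hαβ '' recSet3 A τ := by
  intro p hp
  refine ⟨(eigenCoords hc hαβ).symm p, Frequently.mono hp ?_,
    (eigenCoords hc hαβ).apply_symm_apply p⟩
  rintro n ⟨k, v, hkv⟩
  set Ψ := ((eigenCoords hc hαβ).symm : ℝ × ℝ × ℝ →L[ℝ] EuclideanSpace ℝ (Fin 3))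
  refine ⟨![k, v.1, v.2], ?_⟩
  set y := Matrix.toEuclideanLin ((A ^ n).map (Int.cast : ℤ → ℝ)) ((eigenCoords hc hαβ).symm p) -
    (eigenCoords hc hαβ).symm p - intVec3 ![k, v.1, v.2] with hy
  have hlt : ‖eigenCoords hc hαβ y‖ < (‖Ψ‖ + 1)⁻¹ * Real.exp (-(n * τ)) := by
    rw [hy, eigenCoords_pow_sub_sub hdet hl hc hαβ hA, ContinuousLinearEquiv.apply_symm_apply,
      Prod.norm_def, Prod.norm_def, max_lt_iff, max_lt_iff, norm_neg]
    exact hkv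
  have hΨ : 0 < ‖Ψ‖ + 1 := by positivity
  rw [inv_mul_eq_div, lt_div_iff₀ hΨ] at hlt
  rw [neg_mul]
  calc ‖y‖ = ‖Ψ (eigenCoords hc hαβ y)‖ := by
        rw [ContinuousLinearEquiv.coe_coe, ContinuousLinearEquiv.symm_apply_apply]
    _ ≤ ‖Ψ‖ * ‖eigenCoords hc hαβ y‖ := Ψ.le_opNorm _
    _ ≤ ‖eigenCoords hc hαβ y‖ * (‖Ψ‖ + 1) := by
        nlinarith [norm_nonneg (eigenCoords hc hαβ y)]
    _ < _ := hlt

/-- Example, case `λ^{1/2} < m ≤ λ`: for `A = [[m,0,0],[0,a,b],[0,c,d]]` with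
`m > 1`, `ad - bc = 1` and block eigenvalue `λ > 1`,
`dim_H R_τ = min{(2log m+logλ)/(τ+log m), 3logλ/(τ+logλ),
(logλ+log m)/τ, (τ+logλ)/τ}`. -/
theorem dimH_recSet3_of_le (m a b c d : ℤ) (hm : 1 < m)
    (hdet : a * d - b * c = 1) (l : ℝ) (hl1 : 1 < l)
    (hl : l ^ 2 - ((a : ℝ) + d) * l + 1 = 0)
    (hlm : Real.sqrt l < m) (hml : (m : ℝ) ≤ l)
    (τ : ℝ) (hτ : 0 < τ) :
    dimH (recSet3 ![![m, 0, 0], ![0, a, b], ![0, c, d]] τ)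
      = ENNReal.ofReal (min ((2 * Real.log m + Real.log l) / (τ + Real.log m))
          (min (3 * Real.log l / (τ + Real.log l))
            (min ((Real.log l + Real.log m) / τ)
              ((τ + Real.log l) / τ)))) := by
  have hm2 : (2 : ℝ) ≤ m := by exact_mod_cast hm
  have hm0 : (0 : ℝ) < m := by linarith
  have hlogm : 0 < Real.log m := Real.log_pos (by linarith)
  have hlogl : 0 < Real.log l := Real.log_pos hl1
  have hlogs : Real.log l < 2 * Real.log m := by
    have h : l < (m : ℝ) ^ 2 := (Real.sqrt_lt' hm0).1 hlm
    simpa using Real.log_lt_log (by linarith) h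
  have hdet' : (a : ℝ) * d - b * c = 1 := by exact_mod_cast hdet
  have hinv := inv_eq_trace_sub hl
  have hc : (c : ℝ) ≠ 0 := Int.cast_ne_zero.2 (ne_zero_of_hyperbolic hdet hl1 hl)
  have hαβ : l - a - (l⁻¹ - a) ≠ 0 := by
    rw [sub_sub_sub_cancel_right]
    exact (sub_pos.2 ((inv_lt_one_of_one_lt₀ hl1).trans hl1)).ne'
  rw [← (eigenCoords hc hαβ).dimH_image]
  apply le_antisymm
  · refine (dimH_mono (image_recSet3_subset hdet hl hc hαβ rfl τ)).trans ?_
    refine dimH_eigenRecSet_le (fun v w => ?_) (fun v w => ?_)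
      (fun v hv => one_le_abs_mul_forms hdet hl1 hl hv) hm2 hml hτ (by positivity)
    · simp only [Prod.fst_sub, Prod.snd_sub]; push_cast; ring
    · simp only [Prod.fst_sub, Prod.snd_sub]; push_cast; ring
  · refine le_trans ?_ (dimH_mono (subset_image_recSet3 hdet hl hc hαβ rfl τ))
    refine le_dimH_eigenRecSet (Θ := formsEquiv hc hαβ) (fun v => rfl)
      (fun v hv => one_le_abs_mul_forms hdet hl1 hl hv)
      (σ := fun v => (a * v.1 + b * v.2, c * v.1 + d * v.2)) (fun v => ?_) (fun v => ?_) hm2 hml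
      hlogs hτ (by positivity) ?_ ?_ ?_ ?_
    · push_cast
      linear_combination (-(v.2 : ℝ)) * hl - (v.2 : ℝ) * hdet'
    · rw [hinv]; push_cast
      linear_combination (v.2 : ℝ) * hl + (v.2 : ℝ) * hdet'
    · rw [← le_div_iff₀ (by positivity)]
      exact min_le_left _ _
    · rw [← le_div_iff₀ (by positivity)]
      exact (min_le_right _ _).trans (min_le_left _ _)
    · rw [← le_div_iff₀ hτ]
      exact (min_le_right _ _).trans ((min_le_right _ _).trans (min_le_left _ _))
    · rw [← le_div_iff₀ hτ]
      exact (min_le_right _ _).trans ((min_le_right _ _).trans (min_le_right _ _))
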